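/- arXiv:1401.7896 — 5 statements merged into one kernel-verified Lean document; each statement's English description precedes it below -/
import Mathlib

section
/- Let n ≥ 1 and let F be a Banach space over 𝕜 (𝕜 = ℝ or ℂ). Every continuous n-linear map T : c₀ × ⋯ × c₀ → F is approximable if and only if F contains no copy of c₀. -/
open Filter Topology

noncomputable section

namespace GV

/-- A continuous multilinear map is of *finite type* if it is a finite sum of maps of the form
`(x₁, …, xₙ) ↦ φ₁(x₁)⋯φₙ(xₙ) • f` with the `φᵢ` continuous linear functionals and `f ∈ F`. -/
def IsFiniteType {𝕜 : Type*} [RCLike 𝕜] {n : ℕ} {E : Fin n → Type*}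
    [∀ i, NormedAddCommGroup (E i)] [∀ i, NormedSpace 𝕜 (E i)]
    {F : Type*} [NormedAddCommGroup F] [NormedSpace 𝕜 F]
    (T : ContinuousMultilinearMap 𝕜 E F) : Prop :=
  ∃ (r : ℕ) (φ : Fin r → ∀ i, E i →L[𝕜] 𝕜) (f : Fin r → F),
    ∀ x : ∀ i, E i, T x = ∑ p : Fin r, (∏ i, φ p i (x i)) • f p

/-- A continuous multilinear map is *approximable* if it lies in the operator-norm closure of
the set of finite type continuous multilinear maps. -/
def Approximable {𝕜 : Type*} [RCLike 𝕜] {n : ℕ} {E : Fin n → Type*}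
    [∀ i, NormedAddCommGroup (E i)] [∀ i, NormedSpace 𝕜 (E i)]
    {F : Type*} [NormedAddCommGroup F] [NormedSpace 𝕜 F]
    (T : ContinuousMultilinearMap 𝕜 E F) : Prop :=
  T ∈ closure {S : ContinuousMultilinearMap 𝕜 E F | IsFiniteType S}

/-- A Banach space `F` contains a copy of `c₀` if there is a continuous linear map
`ι : c₀ → F` which is an isomorphism onto its range, i.e. there are constants `0 < c ≤ C`
with `c‖x‖ ≤ ‖ι x‖ ≤ C‖x‖` for all `x ∈ c₀`. -/
def ContainsCopyOfC0 (𝕜 F : Type*) [RCLike 𝕜] [NormedAddCommGroup F] [NormedSpace 𝕜 F] : Prop :=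
  ∃ (ι : ZeroAtInftyContinuousMap ℕ 𝕜 →L[𝕜] F) (c C : ℝ), 0 < c ∧ c ≤ C ∧
    ∀ x : ZeroAtInftyContinuousMap ℕ 𝕜, c * ‖x‖ ≤ ‖ι x‖ ∧ ‖ι x‖ ≤ C * ‖x‖

section CZero

variable {𝕜 : Type*} [RCLike 𝕜]

lemma norm_le_iff {x : ZeroAtInftyContinuousMap ℕ 𝕜} {C : ℝ} (hC : 0 ≤ C) :
    ‖x‖ ≤ C ↔ ∀ j, ‖x j‖ ≤ C := by
  rw [← ZeroAtInftyContinuousMap.norm_toBCF_eq_norm]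
  exact BoundedContinuousFunction.norm_le hC

lemma norm_apply_le (x : ZeroAtInftyContinuousMap ℕ 𝕜) (j : ℕ) : ‖x j‖ ≤ ‖x‖ :=
  (norm_le_iff (norm_nonneg x)).1 le_rfl j

lemma tendsto_coord (x : ZeroAtInftyContinuousMap ℕ 𝕜) : Tendsto x cofinite (𝓝 0) := by
  have h := x.zero_at_infty'
  rwa [Filter.cocompact_eq_cofinite] at h

lemma sum_coord_apply {ι : Type*} (s : Finset ι) (x : ι → ZeroAtInftyContinuousMap ℕ 𝕜) (j : ℕ) :
    (∑ k ∈ s, x k) j = ∑ k ∈ s, x k j := by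
  classical
  induction s using Finset.induction_on with
  | empty => simp
  | insert k s hk ih => simp [Finset.sum_insert hk, ih]

variable (𝕜) in
/-- The unit vectors of `c₀`. -/
def unitVec (k : ℕ) : ZeroAtInftyContinuousMap ℕ 𝕜 where
  toFun j := if j = k then 1 else 0
  continuous_toFun := continuous_of_discreteTopology
  zero_at_infty' := by
    rw [Filter.cocompact_eq_cofinite]
    refine tendsto_const_nhds.congr' ?_
    filter_upwards [(Set.finite_singleton k).compl_mem_cofinite] with j hj
    simp only [Set.mem_compl_iff, Set.mem_singleton_iff] at hj
    simp [hj]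

lemma unitVec_apply (k j : ℕ) : unitVec 𝕜 k j = if j = k then 1 else 0 := rfl

variable (𝕜) in
/-- The coordinate functionals of `c₀`. -/
def coord (k : ℕ) : ZeroAtInftyContinuousMap ℕ 𝕜 →L[𝕜] 𝕜 :=
  LinearMap.mkContinuous ⟨⟨fun x => x k, fun _ _ => rfl⟩, fun _ _ => rfl⟩ 1
    fun x => by simpa using norm_apply_le x k

@[simp] lemma coord_apply (k : ℕ) (x : ZeroAtInftyContinuousMap ℕ 𝕜) : coord 𝕜 k x = x k := rfl

variable (𝕜) in
/-- The projection of `c₀` onto its first `N` coordinates. -/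
def initProj (N : ℕ) : ZeroAtInftyContinuousMap ℕ 𝕜 →L[𝕜] ZeroAtInftyContinuousMap ℕ 𝕜 :=
  ∑ k ∈ Finset.range N, (coord 𝕜 k).smulRight (unitVec 𝕜 k)

lemma initProj_eq_sum (N : ℕ) (x : ZeroAtInftyContinuousMap ℕ 𝕜) :
    initProj 𝕜 N x = ∑ k ∈ Finset.range N, x k • unitVec 𝕜 k := by
  simp [initProj]

lemma initProj_apply (N : ℕ) (x : ZeroAtInftyContinuousMap ℕ 𝕜) (j : ℕ) :
    initProj 𝕜 N x j = if j < N then x j else 0 := by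
  simp [initProj_eq_sum, sum_coord_apply, unitVec_apply]

lemma tendsto_initProj (x : ZeroAtInftyContinuousMap ℕ 𝕜) :
    Tendsto (fun N => initProj 𝕜 N x) atTop (𝓝 x) := by
  rw [Metric.tendsto_atTop]
  intro ε hε
  have h := tendsto_coord x
  rw [Nat.cofinite_eq_atTop, Metric.tendsto_atTop] at h
  obtain ⟨N, hN⟩ := h (ε / 2) (half_pos hε)
  refine ⟨N, fun M hM => ?_⟩
  rw [dist_eq_norm]
  refine lt_of_le_of_lt ((norm_le_iff (half_pos hε).le).2 fun j => ?_) (half_lt_self hε)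
  rw [ZeroAtInftyContinuousMap.sub_apply, initProj_apply]
  split_ifs with hj
  · simpa using (half_pos hε).le
  · simpa using (hN j (by omega)).le

lemma norm_sub_initProj_le (N : ℕ) (x : ZeroAtInftyContinuousMap ℕ 𝕜) :
    ‖x - initProj 𝕜 N x‖ ≤ ‖x‖ := by
  refine (norm_le_iff (norm_nonneg x)).2 fun j => ?_
  rw [ZeroAtInftyContinuousMap.sub_apply, initProj_apply]
  split_ifs with hj
  · simp
  · simpa using norm_apply_le x j

lemma norm_initProj_le (N : ℕ) (x : ZeroAtInftyContinuousMap ℕ 𝕜) :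
    ‖initProj 𝕜 N x‖ ≤ ‖x‖ := by
  refine (norm_le_iff (norm_nonneg x)).2 fun j => ?_
  rw [initProj_apply]
  split_ifs with hj
  · exact norm_apply_le x j
  · simp

/-- The sequences in `x` have pairwise disjoint supports. -/
def DisjointSupports (x : ℕ → ZeroAtInftyContinuousMap ℕ 𝕜) : Prop :=
  ∀ i i', i ≠ i' → ∀ j, x i j = 0 ∨ x i' j = 0

lemma DisjointSupports.norm_sum_le {x : ℕ → ZeroAtInftyContinuousMap ℕ 𝕜}
    (hd : DisjointSupports x) (hx : ∀ i, ‖x i‖ ≤ 1) (s : Finset ℕ) {c : ℕ → 𝕜}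
    (hc : ∀ i, ‖c i‖ ≤ 1) : ‖∑ i ∈ s, c i • x i‖ ≤ 1 := by
  refine (norm_le_iff zero_le_one).2 fun j => ?_
  rw [sum_coord_apply]
  by_cases h : ∃ i ∈ s, x i j ≠ 0
  · obtain ⟨i, his, hi⟩ := h
    rw [Finset.sum_eq_single_of_mem i his]
    · rw [ZeroAtInftyContinuousMap.smul_apply, norm_smul]
      exact mul_le_one₀ (hc i) (norm_nonneg _) ((norm_apply_le _ _).trans (hx i))
    · intro i' _ hne
      have := (hd i' i hne j).resolve_right hi
      simp [this]
  · push Not at h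
    rw [Finset.sum_eq_zero]
    · simp
    · intro i hi
      simp [h i hi]

lemma disjointSupports_unitVec : DisjointSupports (unitVec 𝕜) := by
  intro i i' h j
  simp only [unitVec_apply]
  by_cases hj : j = i
  · right
    rw [if_neg]
    omega
  · simp [hj]

lemma norm_unitVec_le (i : ℕ) : ‖unitVec 𝕜 i‖ ≤ 1 := by
  refine (norm_le_iff zero_le_one).2 fun j => ?_
  rw [unitVec_apply]
  split_ifs <;> simp

end CZero

/-- Rosenthal's disjointification lemma for a nonnegative matrix. -/
lemma rosenthal_disjointification {ε : ℝ} (m : ℕ) (a : ℕ → ℕ → ℝ)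
    (h : ∀ k (s : Finset ℕ), k ∉ s → ∑ j ∈ s, a k j ≤ (m + 1) * ε) :
    ∃ φ : ℕ → ℕ, Function.Injective φ ∧
      ∀ k (s : Finset ℕ), k ∉ s → ∑ j ∈ s, a (φ k) (φ j) ≤ ε := by
  induction m generalizing a with
  | zero => exact ⟨id, Function.injective_id, by simpa using h⟩
  | succ m ih =>
    by_cases hp : ∃ p, ∀ k (s : Finset ℕ), k ∉ s →
        ∑ j ∈ s, a (Nat.pair p k) (Nat.pair p j) ≤ ε
    · obtain ⟨p, hp⟩ := hp
      exact ⟨Nat.pair p, fun i j hij => (Nat.pair_eq_pair.1 hij).2, hp⟩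
    push Not at hp
    choose k s hks hlt using hp
    have hψ : Function.Injective fun p => Nat.pair p (k p) :=
      fun i j hij => (Nat.pair_eq_pair.1 hij).1
    obtain ⟨φ, hφ, hsum⟩ := ih (fun p q => a (Nat.pair p (k p)) (Nat.pair q (k q))) (by
      intro p t hpt
      have hinj : Function.Injective (Nat.pair p) := fun i j hij => (Nat.pair_eq_pair.1 hij).2
      have hdisj : Disjoint (t.image fun q => Nat.pair q (k q)) ((s p).image (Nat.pair p)) := by
        rw [Finset.disjoint_left]
        intro x hx hx'
        obtain ⟨q, hq, rfl⟩ := Finset.mem_image.1 hx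
        obtain ⟨j, hj, hj'⟩ := Finset.mem_image.1 hx'
        exact hpt ((Nat.pair_eq_pair.1 hj').1 ▸ hq)
      have := h (Nat.pair p (k p))
        ((t.image fun q => Nat.pair q (k q)) ∪ (s p).image (Nat.pair p)) (by
          intro hmem
          rcases Finset.mem_union.1 hmem with hx | hx
          · obtain ⟨q, hq, hq'⟩ := Finset.mem_image.1 hx
            exact hpt ((Nat.pair_eq_pair.1 hq').1 ▸ hq)
          · obtain ⟨j, hj, hj'⟩ := Finset.mem_image.1 hx
            exact hks p ((Nat.pair_eq_pair.1 hj').2 ▸ hj))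
      rw [Finset.sum_union hdisj, Finset.sum_image hψ.injOn, Finset.sum_image hinj.injOn] at this
      have h2 := hlt p
      push_cast at this
      linarith)
    exact ⟨_, hψ.comp hφ, hsum⟩

section WeaklyUnconditionallyCauchy

variable {𝕜 : Type*} [RCLike 𝕜] {F : Type*} [NormedAddCommGroup F] [NormedSpace 𝕜 F]

variable (𝕜) in
/-- The series `∑ y j` is weakly unconditionally Cauchy, with constant `C`. -/
def IsWUC (y : ℕ → F) (C : ℝ) : Prop :=
  ∀ (s : Finset ℕ) (c : ℕ → 𝕜), (∀ j, ‖c j‖ ≤ 1) → ‖∑ j ∈ s, c j • y j‖ ≤ C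

lemma IsWUC.nonneg {y : ℕ → F} {C : ℝ} (h : IsWUC 𝕜 y C) : 0 ≤ C := by
  simpa using h ∅ 0 (by simp)

lemma IsWUC.norm_sum_le {y : ℕ → F} {C : ℝ} (h : IsWUC 𝕜 y C) (s : Finset ℕ) (c : ℕ → 𝕜) {r : ℝ}
    (hr : 0 < r) (hc : ∀ j ∈ s, ‖c j‖ ≤ r) : ‖∑ j ∈ s, c j • y j‖ ≤ r * C := by
  classical
  have key := h s (fun j => if j ∈ s then (r : 𝕜)⁻¹ * c j else 0) (by
    intro j
    split_ifs with hj
    · rw [norm_mul, norm_inv, RCLike.norm_ofReal, abs_of_pos hr, inv_mul_le_iff₀ hr]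
      simpa using hc j hj
    · simp)
  have hr' : (r : 𝕜) ≠ 0 := by exact_mod_cast hr.ne'
  have : ∑ j ∈ s, c j • y j = (r : 𝕜) • ∑ j ∈ s, (if j ∈ s then (r : 𝕜)⁻¹ * c j else 0) • y j := by
    rw [Finset.smul_sum]
    refine Finset.sum_congr rfl fun j hj => ?_
    rw [if_pos hj, smul_smul, mul_inv_cancel_left₀ hr']
  rw [this, norm_smul, RCLike.norm_ofReal, abs_of_pos hr]
  gcongr

lemma IsWUC.comp {y : ℕ → F} {C : ℝ} (h : IsWUC 𝕜 y C) {φ : ℕ → ℕ} (hφ : Function.Injective φ) :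
    IsWUC 𝕜 (y ∘ φ) C := by
  intro s c hc
  have := h (s.map ⟨φ, hφ⟩) (fun j => c (Function.invFun φ j)) fun j => hc _
  simpa [Finset.sum_map, Function.leftInverse_invFun hφ _] using this

lemma IsWUC.summable [CompleteSpace F] {y : ℕ → F} {C : ℝ} (h : IsWUC 𝕜 y C)
    (x : ZeroAtInftyContinuousMap ℕ 𝕜) : Summable fun j => x j • y j := by
  rw [summable_iff_vanishing_norm]
  intro ε hε
  have hC := h.nonneg
  have hr : 0 < ε / (C + 1) := by positivity
  have hfin : {j | ¬ ‖x j‖ < ε / (C + 1)}.Finite := by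
    have := (tendsto_coord x).norm.eventually_lt_const (by simpa using hr)
    simpa [Filter.eventually_cofinite] using this
  refine ⟨hfin.toFinset, fun t ht => ?_⟩
  refine lt_of_le_of_lt (h.norm_sum_le t x hr fun j hj => ?_) ?_
  · have := Finset.disjoint_left.1 ht hj
    simp only [Set.Finite.mem_toFinset, Set.mem_ofPred_eq, not_not] at this
    exact this.le
  · rw [div_mul_eq_mul_div, div_lt_iff₀ (by positivity)]
    nlinarith

/-- The operator `c₀ → F` summing a weakly unconditionally Cauchy series. -/
lemma IsWUC.exists_operator [CompleteSpace F] {y : ℕ → F} {C : ℝ} (h : IsWUC 𝕜 y C) :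
    ∃ U : ZeroAtInftyContinuousMap ℕ 𝕜 →L[𝕜] F, ∀ x, HasSum (fun j => x j • y j) (U x) := by
  have hs := h.summable
  refine ⟨LinearMap.mkContinuous ⟨⟨fun x => ∑' j, x j • y j, fun x z => ?_⟩, fun c x => ?_⟩ C
    fun x => ?_, fun x => (hs x).hasSum⟩
  · simp only [ZeroAtInftyContinuousMap.add_apply, add_smul]
    exact (hs x).tsum_add (hs z)
  · simp only [ZeroAtInftyContinuousMap.smul_apply, smul_assoc, RingHom.id_apply]
    exact (hs x).tsum_const_smul c
  · rcases eq_or_ne x 0 with rfl | hx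
    · simp
    · refine le_of_tendsto (hs x).hasSum.norm (Eventually.of_forall fun s => ?_)
      rw [mul_comm]
      exact h.norm_sum_le s x (norm_pos_iff.2 hx) fun j _ => norm_apply_le x j

lemma IsWUC.sum_norm_functional_le {y : ℕ → F} {C : ℝ} (h : IsWUC 𝕜 y C) {f : F →L[𝕜] 𝕜}
    (hf : ‖f‖ ≤ 1) (s : Finset ℕ) : ∑ j ∈ s, ‖f (y j)‖ ≤ C := by
  choose c hc hcf using fun j => RCLike.exists_norm_eq_mul_self (f (y j))
  have h1 : f (∑ j ∈ s, c j • y j) = ((∑ j ∈ s, ‖f (y j)‖ : ℝ) : 𝕜) := by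
    rw [map_sum, RCLike.ofReal_sum]
    exact Finset.sum_congr rfl fun j _ => by rw [map_smul, smul_eq_mul, hcf]
  calc ∑ j ∈ s, ‖f (y j)‖ = ‖f (∑ j ∈ s, c j • y j)‖ := by
        rw [h1, RCLike.norm_ofReal, abs_of_nonneg (Finset.sum_nonneg fun _ _ => norm_nonneg _)]
    _ ≤ 1 * ‖∑ j ∈ s, c j • y j‖ := f.le_of_opNorm_le hf _
    _ ≤ C := by simpa using h s c fun j => (hc j).le

/-- The Bessaga–Pełczyński theorem: a weakly unconditionally Cauchy series whose terms are bounded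
away from zero yields a copy of `c₀`. -/
lemma IsWUC.containsCopyOfC0 [CompleteSpace F] {y : ℕ → F} {C δ : ℝ} (h : IsWUC 𝕜 y C)
    (hδ : 0 < δ) (hy : ∀ j, δ ≤ ‖y j‖) : ContainsCopyOfC0 𝕜 F := by
  choose f hf hfy using fun j => exists_dual_vector'' 𝕜 (y j)
  obtain ⟨m, hm⟩ := exists_nat_ge (C / (δ / 2))
  obtain ⟨φ, hφ, hsum⟩ := rosenthal_disjointification (ε := δ / 2) m
    (fun k j => ‖f k (y j)‖) (fun k s _ => by
      refine (h.sum_norm_functional_le (hf k) s).trans ?_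
      rw [div_le_iff₀ (half_pos hδ)] at hm
      nlinarith)
  obtain ⟨U, hU⟩ := (h.comp hφ).exists_operator
  have hlow : ∀ x, δ / 2 * ‖x‖ ≤ ‖U x‖ := by
    intro x
    have hcoord : ∀ j, δ * ‖x j‖ - ‖x‖ * (δ / 2) ≤ ‖U x‖ := by
      intro j
      refine ge_of_tendsto (hU x).norm ?_
      filter_upwards [eventually_ge_atTop {j}] with s hs
      have hjs : j ∈ s := by simpa using hs
      have hle : ‖f (φ j) (∑ i ∈ s, x i • (y ∘ φ) i)‖ ≤ ‖∑ i ∈ s, x i • (y ∘ φ) i‖ := by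
        simpa using (f (φ j)).le_of_opNorm_le (hf (φ j)) (∑ i ∈ s, x i • (y ∘ φ) i)
      refine le_trans ?_ hle
      rw [← Finset.add_sum_erase s _ hjs, map_add]
      have h1 : δ * ‖x j‖ ≤ ‖f (φ j) (x j • (y ∘ φ) j)‖ := by
        simp only [Function.comp_apply, map_smul, norm_smul, hfy, RCLike.norm_ofReal, abs_norm]
        rw [mul_comm]
        gcongr
        exact hy _
      have h2 : ‖f (φ j) (∑ i ∈ s.erase j, x i • (y ∘ φ) i)‖ ≤ ‖x‖ * (δ / 2) := by
        rw [map_sum]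
        refine (_root_.norm_sum_le _ _).trans ?_
        calc ∑ i ∈ s.erase j, ‖f (φ j) (x i • (y ∘ φ) i)‖
            ≤ ∑ i ∈ s.erase j, ‖x‖ * ‖f (φ j) (y (φ i))‖ := by
              refine Finset.sum_le_sum fun i _ => ?_
              rw [map_smul, norm_smul]
              exact mul_le_mul_of_nonneg_right (norm_apply_le x i) (norm_nonneg _)
          _ ≤ ‖x‖ * (δ / 2) := by
              rw [← Finset.mul_sum]
              exact mul_le_mul_of_nonneg_left (hsum j _ (by simp)) (norm_nonneg _)
      have h3 := norm_sub_le_norm_add (f (φ j) (x j • (y ∘ φ) j))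
        (f (φ j) (∑ i ∈ s.erase j, x i • (y ∘ φ) i))
      linarith
    have : ‖x‖ ≤ (‖U x‖ + ‖x‖ * (δ / 2)) / δ := by
      refine (norm_le_iff (by positivity)).2 fun j => ?_
      rw [le_div_iff₀ hδ]
      linarith [hcoord j]
    rw [le_div_iff₀ hδ] at this
    linarith
  exact ⟨U, δ / 2, max (δ / 2) ‖U‖, half_pos hδ, le_max_left _ _, fun x => ⟨hlow x,
    (U.le_opNorm x).trans (mul_le_mul_of_nonneg_right (le_max_right _ _) (norm_nonneg x))⟩⟩

lemma IsWUC.tendsto_zero [CompleteSpace F] (hF : ¬ ContainsCopyOfC0 𝕜 F) {y : ℕ → F} {C : ℝ}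
    (h : IsWUC 𝕜 y C) : Tendsto y atTop (𝓝 0) := by
  by_contra hy
  rw [Metric.tendsto_atTop] at hy
  push Not at hy
  obtain ⟨δ, hδ, hy⟩ := hy
  obtain ⟨φ, hφ, hle⟩ := extraction_of_frequently_atTop (P := fun k => δ ≤ dist (y k) 0)
    (frequently_atTop.2 hy)
  exact hF ((h.comp hφ.injective).containsCopyOfC0 hδ fun j => by simpa using hle j)

lemma isWUC_map_disjointSupports (U : ZeroAtInftyContinuousMap ℕ 𝕜 →L[𝕜] F)
    {x : ℕ → ZeroAtInftyContinuousMap ℕ 𝕜} (hd : DisjointSupports x) (hx : ∀ i, ‖x i‖ ≤ 1) :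
    IsWUC 𝕜 (fun i => U (x i)) ‖U‖ := by
  intro s c hc
  have : ∑ j ∈ s, c j • U (x j) = U (∑ j ∈ s, c j • x j) := by simp
  rw [this]
  exact U.le_of_opNorm_le_of_le le_rfl (hd.norm_sum_le hx s hc) |>.trans (by simp)

end WeaklyUnconditionallyCauchy

section GlidingHump

variable {𝕜 : Type*} [RCLike 𝕜] {F : Type*} [NormedAddCommGroup F] [NormedSpace 𝕜 F]

lemma tendsto_norm_comp_initProj {T : ℕ → ZeroAtInftyContinuousMap ℕ 𝕜 →L[𝕜] F}
    (h0 : ∀ j, Tendsto (fun k => T k (unitVec 𝕜 j)) atTop (𝓝 0)) (N : ℕ) :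
    Tendsto (fun k => ∑ j ∈ Finset.range N, ‖T k (unitVec 𝕜 j)‖) atTop (𝓝 0) := by
  simpa using tendsto_finsetSum (Finset.range N) fun j _ => (h0 j).norm

lemma norm_apply_initProj_le (T : ZeroAtInftyContinuousMap ℕ 𝕜 →L[𝕜] F) (N : ℕ)
    {x : ZeroAtInftyContinuousMap ℕ 𝕜} (hx : ‖x‖ ≤ 1) :
    ‖T (initProj 𝕜 N x)‖ ≤ ∑ j ∈ Finset.range N, ‖T (unitVec 𝕜 j)‖ := by
  rw [initProj_eq_sum, map_sum]
  refine (norm_sum_le _ _).trans (Finset.sum_le_sum fun j _ => ?_)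
  rw [map_smul, norm_smul]
  exact mul_le_of_le_one_left (norm_nonneg _) ((norm_apply_le x j).trans hx)

/-- Gliding hump: operators on `c₀` bounded away from zero in norm and tending to zero on each
unit vector are, along a subsequence, bounded away from zero on disjoint blocks. -/
lemma exists_disjoint_blocks {T : ℕ → ZeroAtInftyContinuousMap ℕ 𝕜 →L[𝕜] F} {δ : ℝ} (hδ : 0 < δ)
    (hT : ∀ k, δ < ‖T k‖) (h0 : ∀ j, Tendsto (fun k => T k (unitVec 𝕜 j)) atTop (𝓝 0)) :
    ∃ (φ : ℕ → ℕ) (x : ℕ → ZeroAtInftyContinuousMap ℕ 𝕜), StrictMono φ ∧ (∀ i, ‖x i‖ ≤ 1) ∧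
      DisjointSupports x ∧ ∀ i, δ / 2 ≤ ‖T (φ i) (x i)‖ := by
  have step : ∀ N, ∃ k M, ∃ x : ZeroAtInftyContinuousMap ℕ 𝕜, N ≤ k ∧ k < M ∧ ‖x‖ ≤ 1 ∧
      (∀ j, x j ≠ 0 → N ≤ j ∧ j < M) ∧ δ / 2 ≤ ‖T k x‖ := by
    intro N
    obtain ⟨k, hk, hNk⟩ := (((tendsto_norm_comp_initProj h0 N).eventually_lt_const
      (half_pos hδ)).and (eventually_ge_atTop N)).exists
    obtain ⟨x, hx, hδx⟩ := (T k).exists_lt_apply_of_lt_opNorm (hT k)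
    have htrunc : Tendsto (fun M => ‖T k (initProj 𝕜 M x)‖) atTop (𝓝 ‖T k x‖) :=
      (((T k).continuous.tendsto x).comp (tendsto_initProj x)).norm
    obtain ⟨M, hM, hkM⟩ := ((htrunc.eventually_const_lt hδx).and (eventually_gt_atTop k)).exists
    refine ⟨k, M, initProj 𝕜 M x - initProj 𝕜 N (initProj 𝕜 M x), hNk, hkM,
      (norm_sub_initProj_le _ _).trans ((norm_initProj_le _ _).trans hx.le), fun j hj => ?_, ?_⟩
    · by_contra hcon
      refine hj ?_
      by_cases h1 : j < M
      · have h2 : j < N := by omega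
        simp [initProj_apply, h1, h2]
      · simp [initProj_apply, h1]
    · rw [map_sub]
      have h1 := norm_apply_initProj_le (T k) N ((norm_initProj_le M x).trans hx.le)
      have h2 := norm_sub_norm_le (T k (initProj 𝕜 M x)) (T k (initProj 𝕜 N (initProj 𝕜 M x)))
      linarith
  choose k M x hNk hkM hx hsupp hlow using step
  let N : ℕ → ℕ := fun i => M^[i] 0
  have hsucc : ∀ i, N (i + 1) = M (N i) := fun i => Function.iterate_succ_apply' M i 0
  have hN : StrictMono N := strictMono_nat_of_lt_succ fun i => by
    rw [hsucc]
    exact (hNk _).trans_lt (hkM _)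
  have hdisj : ∀ i i', i < i' → ∀ j, x (N i) j = 0 ∨ x (N i') j = 0 := by
    intro i i' hlt j
    by_contra! hcon
    have h1 := (hsupp _ j hcon.1).2
    have h2 := (hsupp _ j hcon.2).1
    have h3 : N (i + 1) ≤ N i' := hN.monotone hlt
    rw [hsucc] at h3
    omega
  refine ⟨fun i => k (N i), fun i => x (N i), strictMono_nat_of_lt_succ fun i => ?_,
    fun i => hx _, fun i i' hne j => ?_, fun i => hlow _⟩
  · refine (hkM (N i)).trans_le ?_
    rw [← hsucc]
    exact hNk _
  · rcases lt_or_gt_of_ne hne with h | h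
    · exact hdisj i i' h j
    · exact (hdisj i' i h j).symm

/-- Operators from `c₀` into a space without copies of `c₀` are approximated by their
restrictions to the first coordinates. -/
lemma exists_norm_sub_comp_initProj_le [CompleteSpace F] (hF : ¬ ContainsCopyOfC0 𝕜 F)
    (U : ZeroAtInftyContinuousMap ℕ 𝕜 →L[𝕜] F) {δ : ℝ} (hδ : 0 < δ) :
    ∃ N, ‖U - U.comp (initProj 𝕜 N)‖ ≤ δ := by
  by_contra! hcon
  obtain ⟨φ, x, -, hx, hd, hlow⟩ := exists_disjoint_blocks hδ hcon (fun j => by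
    refine tendsto_const_nhds.congr' ?_
    filter_upwards [eventually_gt_atTop j] with k hk
    have : initProj 𝕜 k (unitVec 𝕜 j) = unitVec 𝕜 j := by
      ext i
      rw [initProj_apply, unitVec_apply]
      split_ifs <;> first | rfl | omega
    simp [this])
  have hwuc := isWUC_map_disjointSupports U
    (x := fun i => x i - initProj 𝕜 (φ i) (x i)) (by
      intro i i' hne j
      simp only [ZeroAtInftyContinuousMap.sub_apply, initProj_apply]
      rcases hd i i' hne j with h | h
      · left
        simp [h]
      · right
        simp [h])
    (fun i => (norm_sub_initProj_le _ _).trans (hx i))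
  exact hF (hwuc.containsCopyOfC0 (half_pos hδ) fun i => by simpa using hlow i)

lemma norm_add_sum_bilin_le {E₁ E₂ : Type*} [NormedAddCommGroup E₁] [NormedSpace 𝕜 E₁]
    [NormedAddCommGroup E₂] [NormedSpace 𝕜 E₂] (B : E₁ →L[𝕜] E₂ →L[𝕜] F) {M : ℝ}
    (a : ℕ → E₁) (b : ℕ → E₂) (s : Finset ℕ) (u : E₁) (v : E₂)
    (h : ∀ σ : ℕ → 𝕜, (∀ k, ‖σ k‖ ≤ 1) →
      ‖B (u + ∑ k ∈ s, σ k • a k) (v + ∑ k ∈ s, σ k • b k)‖ ≤ M) :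
    ‖B u v + ∑ k ∈ s, B (a k) (b k)‖ ≤ M := by
  induction s using Finset.induction_on generalizing u v with
  | empty => simpa using h 0 (by simp)
  | insert k s hk ih =>
    have hsign : ∀ τ : 𝕜, ‖τ‖ ≤ 1 →
        ‖B (u + τ • a k) (v + τ • b k) + ∑ k ∈ s, B (a k) (b k)‖ ≤ M := by
      intro τ hτ
      refine ih _ _ fun σ hσ => ?_
      have := h (Function.update σ k τ) fun i => by
        rcases eq_or_ne i k with rfl | hi
        · simpa using hτ
        · simpa [hi] using hσ i
      rw [Finset.sum_insert hk, Finset.sum_insert hk, Function.update_self, ← add_assoc,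
        ← add_assoc] at this
      rwa [Finset.sum_congr (g := fun i => σ i • a i) rfl fun i hi => by
          rw [Function.update_of_ne (ne_of_mem_of_not_mem hi hk)],
        Finset.sum_congr (g := fun i => σ i • b i) rfl fun i hi => by
          rw [Function.update_of_ne (ne_of_mem_of_not_mem hi hk)]] at this
    have h1 := hsign 1 (by simp)
    have h2 := hsign (-1) (by simp)
    have hpar : (2 : 𝕜) • (B u v + ∑ i ∈ insert k s, B (a i) (b i)) =
        (B (u + (1 : 𝕜) • a k) (v + (1 : 𝕜) • b k) + ∑ k ∈ s, B (a k) (b k)) +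
        (B (u + (-1 : 𝕜) • a k) (v + (-1 : 𝕜) • b k) + ∑ k ∈ s, B (a k) (b k)) := by
      rw [Finset.sum_insert hk]
      simp only [one_smul, neg_smul, map_add, map_neg, add_apply, neg_apply, two_smul]
      abel
    have hnorm := congrArg norm hpar
    rw [norm_smul, RCLike.norm_ofNat] at hnorm
    have := norm_add_le (B (u + (1 : 𝕜) • a k) (v + (1 : 𝕜) • b k) + ∑ k ∈ s, B (a k) (b k))
      (B (u + (-1 : 𝕜) • a k) (v + (-1 : 𝕜) • b k) + ∑ k ∈ s, B (a k) (b k))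
    linarith

/-- If `F` contains no copy of `c₀`, neither does the space of operators from `c₀` to `F`. -/
lemma not_containsCopyOfC0_operators [CompleteSpace F] (hF : ¬ ContainsCopyOfC0 𝕜 F) :
    ¬ ContainsCopyOfC0 𝕜 (ZeroAtInftyContinuousMap ℕ 𝕜 →L[𝕜] F) := by
  rintro ⟨B, c, C, hc, -, hB⟩
  have hunit : ∀ k, c / 2 < ‖B (unitVec 𝕜 k)‖ := by
    intro k
    have h1 := (hB (unitVec 𝕜 k)).1
    have h2 : 1 ≤ ‖unitVec 𝕜 k‖ := by simpa [unitVec_apply] using norm_apply_le (unitVec 𝕜 k) k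
    nlinarith
  obtain ⟨φ, x, hφ, hx, hd, hlow⟩ := exists_disjoint_blocks (half_pos hc) hunit fun j =>
    (isWUC_map_disjointSupports (B.flip (unitVec 𝕜 j)) disjointSupports_unitVec
      norm_unitVec_le).tendsto_zero hF
  have hwuc : IsWUC 𝕜 (fun i => B (unitVec 𝕜 (φ i)) (x i)) ‖B‖ := by
    intro s r hr
    have hd' : DisjointSupports fun i => unitVec 𝕜 (φ i) := fun i i' hne =>
      disjointSupports_unitVec _ _ (hφ.injective.ne hne)
    have := norm_add_sum_bilin_le B (M := ‖B‖) (fun i => r i • unitVec 𝕜 (φ i)) x s 0 0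
      fun σ hσ => by
        simp only [zero_add, smul_smul]
        have h1 := hd'.norm_sum_le (fun i => norm_unitVec_le _) s (c := fun i => σ i * r i)
          fun i => by
            rw [norm_mul]
            exact mul_le_one₀ (hσ i) (norm_nonneg _) (hr i)
        have h2 := hd.norm_sum_le hx s hσ
        refine (B.le_opNorm₂ _ _).trans ?_
        calc _ ≤ ‖B‖ * 1 * 1 := by gcongr
          _ = ‖B‖ := by ring
    simpa using this
  exact hF (hwuc.containsCopyOfC0 (half_pos (half_pos hc)) hlow)

end GlidingHump

section Multilinear

universe u v

variable {𝕜 : Type*} [RCLike 𝕜]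

lemma ContainsCopyOfC0.of_linearIsometry {F G : Type*} [NormedAddCommGroup F] [NormedSpace 𝕜 F]
    [NormedAddCommGroup G] [NormedSpace 𝕜 G] (h : ContainsCopyOfC0 𝕜 F) (j : F →ₗᵢ[𝕜] G) :
    ContainsCopyOfC0 𝕜 G := by
  obtain ⟨ι, c, C, hc, hcC, hι⟩ := h
  exact ⟨j.toContinuousLinearMap.comp ι, c, C, hc, hcC, fun x => by simpa using hι x⟩

variable (𝕜) in
/-- Currying of the first variable, for maps all of whose variables range over the same space. -/
def curryFirst (E F : Type*) [NormedAddCommGroup E] [NormedSpace 𝕜 E] [NormedAddCommGroup F]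
    [NormedSpace 𝕜 F] (n : ℕ) :
    ContinuousMultilinearMap 𝕜 (fun _ : Fin (n + 1) => E) F ≃ₗᵢ[𝕜]
      (E →L[𝕜] ContinuousMultilinearMap 𝕜 (fun _ : Fin n => E) F) :=
  continuousMultilinearCurryLeftEquiv 𝕜 (fun _ : Fin (n + 1) => E) F

lemma curryFirst_apply {E F : Type*} [NormedAddCommGroup E] [NormedSpace 𝕜 E]
    [NormedAddCommGroup F] [NormedSpace 𝕜 F] {n : ℕ}
    (T : ContinuousMultilinearMap 𝕜 (fun _ : Fin (n + 1) => E) F) (x : E) (v : Fin n → E) :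
    curryFirst 𝕜 E F n T x v = T (Fin.cons x v) :=
  rfl

lemma curryFirst_symm_apply {E F : Type*} [NormedAddCommGroup E] [NormedSpace 𝕜 E]
    [NormedAddCommGroup F] [NormedSpace 𝕜 F] {n : ℕ}
    (U : E →L[𝕜] ContinuousMultilinearMap 𝕜 (fun _ : Fin n => E) F) (v : Fin (n + 1) → E) :
    (curryFirst 𝕜 E F n).symm U v = U (v 0) (Fin.tail v) :=
  rfl

variable {E : Type u} [NormedAddCommGroup E] [NormedSpace 𝕜 E]
  {F : Type v} [NormedAddCommGroup F] [NormedSpace 𝕜 F]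

lemma not_containsCopyOfC0_multilinear [CompleteSpace F]
    (hE : ∀ (G : Type (max u v)) [NormedAddCommGroup G] [NormedSpace 𝕜 G] [CompleteSpace G],
      ¬ ContainsCopyOfC0 𝕜 G → ¬ ContainsCopyOfC0 𝕜 (E →L[𝕜] G))
    (hF : ¬ ContainsCopyOfC0 𝕜 F) (n : ℕ) :
    ¬ ContainsCopyOfC0 𝕜 (ContinuousMultilinearMap 𝕜 (fun _ : Fin n => E) F) := by
  induction n with
  | zero =>
    exact fun h => hF (h.of_linearIsometry (continuousMultilinearCurryFin0 𝕜 E F).toLinearIsometry)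
  | succ n ih =>
    exact fun h => hE _ ih (h.of_linearIsometry (curryFirst 𝕜 E F n).toLinearIsometry)

section FiniteType

variable {n : ℕ} {E : Fin n → Type*} [∀ i, NormedAddCommGroup (E i)] [∀ i, NormedSpace 𝕜 (E i)]

lemma IsFiniteType.zero : IsFiniteType (0 : ContinuousMultilinearMap 𝕜 E F) :=
  ⟨0, Fin.elim0, Fin.elim0, by simp⟩

lemma IsFiniteType.add {S T : ContinuousMultilinearMap 𝕜 E F} (hS : IsFiniteType S)
    (hT : IsFiniteType T) : IsFiniteType (S + T) := by
  obtain ⟨r, φ, f, h⟩ := hS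
  obtain ⟨r', φ', f', h'⟩ := hT
  exact ⟨r + r', Fin.append φ φ', Fin.append f f', fun x => by simp [Fin.sum_univ_add, h, h']⟩

lemma Approximable.add {S T : ContinuousMultilinearMap 𝕜 E F} (hS : Approximable S)
    (hT : Approximable T) : Approximable (S + T) :=
  map_mem_closure₂ continuous_add hS hT fun _ h _ h' => IsFiniteType.add h h'

lemma Approximable.sum {ι : Type*} (s : Finset ι) {T : ι → ContinuousMultilinearMap 𝕜 E F}
    (hT : ∀ i ∈ s, Approximable (T i)) : Approximable (∑ i ∈ s, T i) :=
  Finset.sum_induction _ Approximable (fun _ _ => Approximable.add)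
    (subset_closure IsFiniteType.zero) hT

lemma approximable_of_forall_norm_sub_le {T : ContinuousMultilinearMap 𝕜 E F}
    (h : ∀ ε > 0, ∃ S, Approximable S ∧ ‖T - S‖ ≤ ε) : Approximable T := by
  unfold Approximable
  rw [← closure_closure, Metric.mem_closure_iff]
  intro ε hε
  obtain ⟨S, hS, hTS⟩ := h (ε / 2) (half_pos hε)
  exact ⟨S, hS, by rw [dist_eq_norm]; linarith⟩

end FiniteType

/-- Multiplication of a multilinear map by a functional in a new first variable. -/
def consFunctional {n : ℕ} (ψ : E →L[𝕜] 𝕜)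
    (S : ContinuousMultilinearMap 𝕜 (fun _ : Fin n => E) F) :
    ContinuousMultilinearMap 𝕜 (fun _ : Fin (n + 1) => E) F :=
  (curryFirst 𝕜 E F n).symm (ψ.smulRight S)

lemma consFunctional_apply {n : ℕ}
    (ψ : E →L[𝕜] 𝕜) (S : ContinuousMultilinearMap 𝕜 (fun _ : Fin n => E) F)
    (v : Fin (n + 1) → E) : consFunctional ψ S v = ψ (v 0) • S (Fin.tail v) := by
  simp [consFunctional, curryFirst_symm_apply]

lemma Approximable.consFunctional {n : ℕ}
    (ψ : E →L[𝕜] 𝕜) {S : ContinuousMultilinearMap 𝕜 (fun _ : Fin n => E) F}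
    (hS : Approximable S) : Approximable (consFunctional ψ S) := by
  have hcont : Continuous (GV.consFunctional (F := F) (n := n) ψ) :=
    (LinearIsometryEquiv.continuous _).comp (ContinuousLinearMap.smulRightL 𝕜 E _ ψ).continuous
  refine map_mem_closure hcont hS ?_
  rintro R ⟨r, φ, f, h⟩
  refine ⟨r, fun p => Fin.cons ψ (φ p), f, fun x => ?_⟩
  simp [consFunctional_apply, h, Fin.prod_univ_succ, Finset.smul_sum, smul_smul, Fin.tail]

lemma approximable_of_forall_operator_approximable [CompleteSpace F]
    (hE : ∀ (G : Type (max u v)) [NormedAddCommGroup G] [NormedSpace 𝕜 G] [CompleteSpace G],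
      ¬ ContainsCopyOfC0 𝕜 G → ¬ ContainsCopyOfC0 𝕜 (E →L[𝕜] G))
    (happrox : ∀ (G : Type (max u v)) [NormedAddCommGroup G] [NormedSpace 𝕜 G] [CompleteSpace G],
      ¬ ContainsCopyOfC0 𝕜 G → ∀ (U : E →L[𝕜] G) (ε : ℝ), 0 < ε →
        ∃ (N : ℕ) (ψ : ℕ → E →L[𝕜] 𝕜) (e : ℕ → E),
          ‖U - ∑ p ∈ Finset.range N, (ψ p).smulRight (U (e p))‖ ≤ ε)
    (hF : ¬ ContainsCopyOfC0 𝕜 F) {n : ℕ}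
    (T : ContinuousMultilinearMap 𝕜 (fun _ : Fin n => E) F) : Approximable T := by
  induction n with
  | zero =>
    refine subset_closure ⟨1, fun _ i => i.elim0, fun _ => T 0, fun x => ?_⟩
    simp [Subsingleton.elim x 0]
  | succ n ih =>
    refine approximable_of_forall_norm_sub_le fun ε hε => ?_
    obtain ⟨N, ψ, e, hN⟩ := happrox _ (not_containsCopyOfC0_multilinear hE hF n)
      (curryFirst 𝕜 E F n T) ε hε
    refine ⟨∑ p ∈ Finset.range N, consFunctional (ψ p) (curryFirst 𝕜 E F n T (e p)),
      Approximable.sum _ fun p _ => (ih _).consFunctional _, ?_⟩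
    have hcurry : curryFirst 𝕜 E F n
        (T - ∑ p ∈ Finset.range N, consFunctional (ψ p) (curryFirst 𝕜 E F n T (e p))) =
        curryFirst 𝕜 E F n T -
          ∑ p ∈ Finset.range N, (ψ p).smulRight (curryFirst 𝕜 E F n T (e p)) := by
      ext x v
      simp [curryFirst_apply, consFunctional_apply]
    rw [← (curryFirst 𝕜 E F n).norm_map, hcurry]
    exact hN

lemma exists_not_approximable
    (hE : ∀ (r : ℕ) (ψ : Fin r → E →L[𝕜] 𝕜), ∃ x : E, ‖x‖ = 1 ∧ ∀ p, ψ p x = 0)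
    {ι : E →L[𝕜] F} {c : ℝ} (hc : 0 < c) (hι : ∀ x, c * ‖x‖ ≤ ‖ι x‖) (n : ℕ) :
    ∃ T : ContinuousMultilinearMap 𝕜 (fun _ : Fin (n + 1) => E) F, ¬ Approximable T := by
  obtain ⟨e, he, -⟩ := hE 0 Fin.elim0
  obtain ⟨θ, -, hθ⟩ := exists_dual_vector'' 𝕜 e
  rw [he, RCLike.ofReal_one] at hθ
  let R : ContinuousMultilinearMap 𝕜 (fun _ : Fin n => E) 𝕜 :=
    (ContinuousMultilinearMap.mkPiAlgebra 𝕜 (Fin n) 𝕜).compContinuousLinearMap fun _ => θ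
  let T := (curryFirst 𝕜 E F n).symm
    ((ContinuousMultilinearMap.smulRightL 𝕜 _ F R).comp ι)
  refine ⟨T, fun hT => ?_⟩
  obtain ⟨S, ⟨r, φ, f, hS⟩, hTS⟩ := Metric.mem_closure_iff.1 hT c hc
  obtain ⟨x, hx, hφx⟩ := hE r fun p => φ p 0
  let v : Fin (n + 1) → E := Fin.cons x fun _ => e
  have hTv : T v = ι x := by
    simp [T, R, v, curryFirst_symm_apply, hθ]
  have hSv : S v = 0 := by
    rw [hS]
    exact Finset.sum_eq_zero fun p _ => by simp [Fin.prod_univ_succ, v, hφx]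
  have hv : ∏ i, ‖v i‖ ≤ 1 := by
    refine Finset.prod_le_one (fun _ _ => norm_nonneg _) fun i _ => ?_
    refine Fin.cases ?_ (fun i => ?_) i
    · simp [v, hx]
    · simp [v, he]
  have hle : ‖ι x‖ ≤ ‖T - S‖ := by
    have := (T - S).le_opNorm v
    rw [sub_apply, hTv, hSv, sub_zero] at this
    exact this.trans (mul_le_of_le_one_right (norm_nonneg _) hv)
  have hlow := hι x
  rw [hx, mul_one] at hlow
  rw [dist_eq_norm] at hTS
  linarith

end Multilinear

section

variable {𝕜 : Type*} [RCLike 𝕜]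

lemma exists_norm_eq_one_forall_apply_eq_zero {r : ℕ}
    (ψ : Fin r → ZeroAtInftyContinuousMap ℕ 𝕜 →L[𝕜] 𝕜) :
    ∃ x : ZeroAtInftyContinuousMap ℕ 𝕜, ‖x‖ = 1 ∧ ∀ p, ψ p x = 0 := by
  let L : (Fin (r + 1) → 𝕜) →ₗ[𝕜] ZeroAtInftyContinuousMap ℕ 𝕜 :=
    Fintype.linearCombination 𝕜 fun i : Fin (r + 1) => unitVec 𝕜 (i : ℕ)
  let Ψ : ZeroAtInftyContinuousMap ℕ 𝕜 →ₗ[𝕜] (Fin r → 𝕜) :=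
    LinearMap.pi fun p => (ψ p).toLinearMap
  have hker : LinearMap.ker (Ψ ∘ₗ L) ≠ ⊥ := LinearMap.ker_ne_bot_of_finrank_lt (by simp)
  obtain ⟨a, ha, hne⟩ := (Submodule.ne_bot_iff _).1 hker
  have hx : L a ≠ 0 := by
    intro h0
    refine hne (funext fun i => ?_)
    have := congrArg (fun z : ZeroAtInftyContinuousMap ℕ 𝕜 => z (i : ℕ)) h0
    simpa [L, Fintype.linearCombination_apply, sum_coord_apply, unitVec_apply, Fin.val_inj]
      using this
  refine ⟨((‖L a‖⁻¹ : ℝ) : 𝕜) • L a, ?_, fun p => ?_⟩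
  · simp [norm_smul, hx]
  · have : ψ p (L a) = 0 := congrFun (LinearMap.mem_ker.1 ha) p
    simp [this]

end

theorem stmt0 (𝕜 : Type*) [RCLike 𝕜] (n : ℕ) (hn : 1 ≤ n)
    (F : Type*) [NormedAddCommGroup F] [NormedSpace 𝕜 F] [CompleteSpace F] :
    (∀ T : ContinuousMultilinearMap 𝕜 (fun _ : Fin n => ZeroAtInftyContinuousMap ℕ 𝕜) F,
        Approximable T) ↔ ¬ ContainsCopyOfC0 𝕜 F := by
  refine ⟨?_, fun hF => approximable_of_forall_operator_approximable
    (fun _ => not_containsCopyOfC0_operators) (fun G _ _ _ hG U ε hε => ?_) hF⟩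
  · obtain ⟨n, rfl⟩ := Nat.exists_eq_add_of_le' hn
    rintro h ⟨ι, c, C, hc, -, hι⟩
    obtain ⟨T, hT⟩ := exists_not_approximable
      (fun _ => exists_norm_eq_one_forall_apply_eq_zero) hc (fun x => (hι x).1) n
    exact hT (h T)
  · obtain ⟨N, hN⟩ := exists_norm_sub_comp_initProj_le hG U hε
    refine ⟨N, coord 𝕜, unitVec 𝕜, le_of_eq_of_le ?_ hN⟩
    congr 2
    ext x
    simp [initProj_eq_sum]

end GV
end
end

section
/- Let n ≥ 1. The map T : c₀ × ⋯ × c₀ → c₀ (n factors) defined by T(x₁,…,xₙ) = x₁(0)·x₂(0)⋯x_{n−1}(0)·xₙ, i.e., whose j-th coordinate is x₁(0)⋯x_{n−1}(0)·xₙ(j), is a well-defined continuous n-linear map of operator norm 1 which is not approximable. Consequently, if a Banach space F contains a subspace isomorphic to c₀, then there exists a continuous n-linear map from c₀ × ⋯ × c₀ to F which is not approximable. -/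
open Filter Topology

noncomputable section

namespace GV

open scoped ZeroAtInfty

section

variable {𝕜 : Type*} [RCLike 𝕜]

/-- Evaluation at a point, as a continuous linear functional on `c₀`. -/
def evalC0 (𝕜 : Type*) [RCLike 𝕜] (j : ℕ) : C₀(ℕ, 𝕜) →L[𝕜] 𝕜 :=
  LinearMap.mkContinuous
    { toFun := fun x => x j
      map_add' := fun _ _ => rfl
      map_smul' := fun _ _ => rfl } 1
    fun x => by simpa using x.toBCF.norm_coe_le_norm j

@[simp]
theorem evalC0_apply (j : ℕ) (x : C₀(ℕ, 𝕜)) : evalC0 𝕜 j x = x j := rfl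

theorem norm_apply_le_norm (x : C₀(ℕ, 𝕜)) (j : ℕ) : ‖x j‖ ≤ ‖x‖ :=
  x.toBCF.norm_coe_le_norm j

/-- A finitely supported sequence, viewed as an element of `c₀`. -/
def finsuppToC0 (𝕜 : Type*) [RCLike 𝕜] : (ℕ →₀ 𝕜) →ₗ[𝕜] C₀(ℕ, 𝕜) where
  toFun v :=
    { toFun := v
      continuous_toFun := continuous_of_discreteTopology
      zero_at_infty' := by
        rw [cocompact_eq_cofinite]
        refine tendsto_nhds_of_eventually_eq ?_
        filter_upwards [Set.Finite.compl_mem_cofinite v.hasFiniteSupport] with j hj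
        simpa using hj }
  map_add' _ _ := rfl
  map_smul' _ _ := rfl

@[simp]
theorem finsuppToC0_apply (v : ℕ →₀ 𝕜) (j : ℕ) : finsuppToC0 𝕜 v j = v j := rfl

theorem finsuppToC0_injective : Function.Injective (finsuppToC0 𝕜) := fun v w h => by
  ext j
  simpa using DFunLike.congr_fun h j

/-- The first unit vector of `c₀`. -/
def e0 (𝕜 : Type*) [RCLike 𝕜] : C₀(ℕ, 𝕜) := finsuppToC0 𝕜 (Finsupp.single 0 1)

@[simp]
theorem e0_apply_zero : e0 𝕜 0 = 1 := by simp [e0]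

theorem norm_e0 : ‖e0 𝕜‖ = 1 := by
  refine le_antisymm ?_ (by simpa using norm_apply_le_norm (e0 𝕜) 0)
  rw [← ZeroAtInftyContinuousMap.norm_toBCF_eq_norm,
    BoundedContinuousFunction.norm_le zero_le_one]
  intro j
  change ‖(Finsupp.single 0 1 : ℕ →₀ 𝕜) j‖ ≤ 1
  by_cases hj : j = 0
  · simp [hj]
  · simp [Finsupp.single_eq_of_ne hj]

/-- `c₀` is infinite-dimensional: finitely many functionals have a common nontrivial zero. -/
theorem exists_ne_zero_forall_apply_eq_zero {r : ℕ} (φ : Fin r → C₀(ℕ, 𝕜) →L[𝕜] 𝕜) :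
    ∃ x : C₀(ℕ, 𝕜), x ≠ 0 ∧ ∀ p, φ p x = 0 := by
  by_contra! h
  let Φ : C₀(ℕ, 𝕜) →ₗ[𝕜] Fin r → 𝕜 := LinearMap.pi fun p => (φ p).toLinearMap
  have hΦ : Function.Injective Φ := by
    rw [injective_iff_map_eq_zero]
    intro x hx
    by_contra hx0
    obtain ⟨p, hp⟩ := h x hx0
    exact hp (congrFun hx p)
  have : Module.Finite 𝕜 (ℕ →₀ 𝕜) :=
    Module.Finite.of_injective (Φ ∘ₗ finsuppToC0 𝕜) (hΦ.comp finsuppToC0_injective)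
  exact not_finite_iff_infinite.2 inferInstance
    (Module.Finite.finite_basis (Finsupp.basisSingleOne (R := 𝕜) (ι := ℕ)))

/-- If fixing all variables but the last turns `T` into a map bounded below on `c₀`, then `T` is
not approximable. -/
theorem not_approximable_of_bounded_below {m : ℕ} {F : Type*} [NormedAddCommGroup F]
    [NormedSpace 𝕜 F]
    (T : ContinuousMultilinearMap 𝕜 (fun _ : Fin (m + 1) => C₀(ℕ, 𝕜)) F) {c : ℝ} (hc : 0 < c)
    (y : Fin m → C₀(ℕ, 𝕜)) (hy : ∀ i, ‖y i‖ ≤ 1)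
    (h : ∀ x, c * ‖x‖ ≤ ‖T (Fin.snoc (α := fun _ => C₀(ℕ, 𝕜)) y x)‖) : ¬ Approximable T := by
  intro hT
  obtain ⟨S, ⟨r, φ, f, hS⟩, hTS⟩ := (Metric.mem_closure_iff
    (α := ContinuousMultilinearMap 𝕜 (fun _ : Fin (m + 1) => C₀(ℕ, 𝕜)) F)).1 hT c hc
  obtain ⟨x, hx, hφx⟩ := exists_ne_zero_forall_apply_eq_zero fun p => φ p (Fin.last m)
  set z : Fin (m + 1) → C₀(ℕ, 𝕜) := Fin.snoc (α := fun _ => C₀(ℕ, 𝕜)) y x with hz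
  have hSz : S z = 0 := by
    rw [hS]
    refine Finset.sum_eq_zero fun p _ => ?_
    rw [Finset.prod_eq_zero (Finset.mem_univ (Fin.last m)), zero_smul]
    simpa [hz] using hφx p
  have hprod : ∏ i, ‖z i‖ ≤ ‖x‖ := by
    rw [Fin.prod_univ_castSucc]
    simp only [hz, Fin.snoc_castSucc, Fin.snoc_last]
    exact mul_le_of_le_one_left (norm_nonneg _)
      (Finset.prod_le_one (fun _ _ => norm_nonneg _) fun i _ => hy i)
  have : c * ‖x‖ < c * ‖x‖ := calc
    c * ‖x‖ ≤ ‖(T - S) z‖ := by simpa [hSz] using h x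
    _ ≤ ‖T - S‖ * ∏ i, ‖z i‖ := (T - S).le_opNorm z
    _ ≤ ‖T - S‖ * ‖x‖ := by gcongr
    _ < c * ‖x‖ :=
      mul_lt_mul_of_pos_right ((dist_eq_norm T S).symm.trans_lt hTS) (norm_pos_iff.2 hx)
  exact this.false

/-- The map `(x₁, …, xₙ) ↦ x₁(0) ⋯ xₙ₋₁(0) xₙ` on `c₀`. -/
def prodEvalSMul (𝕜 : Type*) [RCLike 𝕜] (m : ℕ) :
    ContinuousMultilinearMap 𝕜 (fun _ : Fin (m + 1) => C₀(ℕ, 𝕜)) C₀(ℕ, 𝕜) :=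
  ContinuousMultilinearMap.uncurryRight
    (((ContinuousMultilinearMap.mkPiAlgebra 𝕜 (Fin m) 𝕜).compContinuousLinearMap
      fun _ => evalC0 𝕜 0).smulRight (ContinuousLinearMap.id 𝕜 C₀(ℕ, 𝕜)))

theorem prodEvalSMul_apply {m : ℕ} (x : Fin (m + 1) → C₀(ℕ, 𝕜)) :
    prodEvalSMul 𝕜 m x = (∏ i : Fin m, x i.castSucc 0) • x (Fin.last m) := by
  simp [prodEvalSMul, Fin.init]

theorem prodEvalSMul_snoc_e0 {m : ℕ} (x : C₀(ℕ, 𝕜)) :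
    prodEvalSMul 𝕜 m (Fin.snoc (α := fun _ => C₀(ℕ, 𝕜)) (fun _ => e0 𝕜) x) = x := by
  simp [prodEvalSMul_apply]

theorem norm_prodEvalSMul (m : ℕ) : ‖prodEvalSMul 𝕜 m‖ = 1 := by
  refine le_antisymm (ContinuousMultilinearMap.opNorm_le_bound zero_le_one fun x => ?_) ?_
  · rw [prodEvalSMul_apply, norm_smul, norm_prod, one_mul, Fin.prod_univ_castSucc]
    gcongr
    exact norm_apply_le_norm _ _
  · simpa [prodEvalSMul_apply, norm_e0] using (prodEvalSMul 𝕜 m).le_opNorm fun _ => e0 𝕜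

end

theorem stmt1 (𝕜 : Type*) [RCLike 𝕜] (m : ℕ) :
    (∃ T : ContinuousMultilinearMap 𝕜 (fun _ : Fin (m + 1) => ZeroAtInftyContinuousMap ℕ 𝕜)
        (ZeroAtInftyContinuousMap ℕ 𝕜),
      (∀ (x : Fin (m + 1) → ZeroAtInftyContinuousMap ℕ 𝕜) (j : ℕ),
          T x j = (∏ i : Fin m, x i.castSucc 0) * x (Fin.last m) j) ∧
      ‖T‖ = 1 ∧ ¬ Approximable T) ∧
    (∀ (F : Type*) [NormedAddCommGroup F] [NormedSpace 𝕜 F] [CompleteSpace F],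
      ContainsCopyOfC0 𝕜 F →
      ∃ T' : ContinuousMultilinearMap 𝕜 (fun _ : Fin (m + 1) => ZeroAtInftyContinuousMap ℕ 𝕜) F,
        ¬ Approximable T') := by
  refine ⟨⟨prodEvalSMul 𝕜 m, fun x j => ?_, norm_prodEvalSMul m, ?_⟩, ?_⟩
  · simp [prodEvalSMul_apply]
  · refine not_approximable_of_bounded_below _ one_pos (fun _ => e0 𝕜)
      (fun _ => norm_e0.le) fun x => ?_
    rw [prodEvalSMul_snoc_e0, one_mul]
  · rintro F _ _ _ ⟨ι, c, C, hc, -, hι⟩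
    refine ⟨ι.compContinuousMultilinearMap (prodEvalSMul 𝕜 m),
      not_approximable_of_bounded_below _ hc (fun _ => e0 𝕜) (fun _ => norm_e0.le) fun x => ?_⟩
    rw [ContinuousLinearMap.compContinuousMultilinearMap_coe, Function.comp_apply,
      prodEvalSMul_snoc_e0]
    exact (hι x).1

end GV
end
end

section
/- Let n ≥ 1 and let F be a Banach space which contains no copy of c₀. Then every continuous n-linear map T : c₀ × ⋯ × c₀ → F is weakly sequentially continuous: whenever, for each 1 ≤ k ≤ n, (x_k^j)_{j∈ℕ} is a sequence in c₀ converging weakly to x_k (i.e., φ(x_k^j) → φ(x_k) for every continuous linear functional φ on c₀), then ‖T(x_1^j,…,x_n^j) − T(x₁,…,xₙ)‖ → 0. -/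
open Filter Topology

noncomputable section

namespace GV

/-- A continuous multilinear map is *weakly sequentially continuous* if it sends coordinatewise
weakly convergent sequences to norm convergent sequences. -/
def WeaklySeqContinuous {𝕜 : Type*} [RCLike 𝕜] {n : ℕ} {E : Fin n → Type*}
    [∀ i, NormedAddCommGroup (E i)] [∀ i, NormedSpace 𝕜 (E i)]
    {F : Type*} [NormedAddCommGroup F] [NormedSpace 𝕜 F]
    (T : ContinuousMultilinearMap 𝕜 E F) : Prop :=
  ∀ (x : ℕ → ∀ i, E i) (x₀ : ∀ i, E i),
    (∀ i (φ : E i →L[𝕜] 𝕜), Tendsto (fun j => φ (x j i)) atTop (𝓝 (φ (x₀ i)))) →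
    Tendsto (fun j => T (x j)) atTop (𝓝 (T x₀))

/-- **Rosenthal's lemma**: a nonnegative matrix with uniformly bounded row sums has an infinite
principal submatrix whose off-diagonal row sums are small. -/
lemma exists_injective_offDiag_sum_le {ε : ℝ} (hε : 0 ≤ ε) (k : ℕ) (a : ℕ → ℕ → ℝ)
    (ha : ∀ m i, 0 ≤ a m i) (hsum : ∀ m (A : Finset ℕ), ∑ i ∈ A, a m i ≤ k * ε) :
    ∃ σ : ℕ → ℕ, Function.Injective σ ∧
      ∀ m (A : Finset ℕ), m ∉ A → ∑ i ∈ A, a (σ m) (σ i) ≤ ε := by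
  induction k generalizing a with
  | zero =>
    exact ⟨id, Function.injective_id, fun m A _ => (hsum m A).trans (by simpa using hε)⟩
  | succ k ih =>
    by_contra! hcon
    have hpair (p : ℕ) : Function.Injective (Nat.pair p) := fun i j h => (Nat.pair_eq_pair.1 h).2
    choose d A hdA hA using fun p => hcon (Nat.pair p) (hpair p)
    let τ : ℕ → ℕ := fun p => Nat.pair p (d p)
    have hτ : Function.Injective τ := fun p q h => (Nat.pair_eq_pair.1 h).1
    obtain ⟨σ, hσ, hoff⟩ := ih (fun p q => a (τ p) (τ q)) (fun _ _ => ha _ _) fun p B => by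
      have hdisj : Disjoint (B.image τ) ((A p).image (Nat.pair p)) := by
        rw [Finset.disjoint_left]
        simp only [Finset.mem_image, not_exists, not_and]
        rintro _ ⟨q, -, rfl⟩ i hi h
        obtain ⟨rfl, rfl⟩ := Nat.pair_eq_pair.1 h
        exact hdA _ hi
      have h := hsum (τ p) (B.image τ ∪ (A p).image (Nat.pair p))
      rw [Finset.sum_union hdisj, Finset.sum_image hτ.injOn,
        Finset.sum_image (hpair p).injOn] at h
      push_cast at h
      linarith [hA p]
    obtain ⟨m, B, hmB, hB⟩ := hcon (τ ∘ σ) (hτ.comp hσ)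
    exact hB.not_ge (hoff m B hmB)

/-- Gliding hump: a uniformly bounded pointwise null sequence of nonnegative null sequences has a
subfamily with uniformly bounded partial sums. -/
lemma exists_sum_le_of_tendsto_zero {B : ℝ} (hB : 0 ≤ B) (y : ℕ → ℕ → ℝ)
    (hyB : ∀ j t, y j t ≤ B) (hy₀ : ∀ j, Tendsto (y j) atTop (𝓝 0))
    (hy : ∀ t, Tendsto (fun j => y j t) atTop (𝓝 0)) :
    ∃ ψ : ℕ → ℕ, ∀ M t, ∑ m ∈ Finset.range M, y (ψ m) t ≤ B + 1 := by
  have step (q : {q : ℕ × (ℕ → ℝ) // Tendsto q.2 atTop (𝓝 0) ∧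
      ∀ t, q.2 t ≤ B + 1 - (1 / 2) ^ q.1}) :
      ∃ j, ∀ t, q.1.2 t + y j t ≤ B + 1 - (1 / 2) ^ (q.1.1 + 1) := by
    obtain ⟨⟨m, S⟩, hS, hSB⟩ := q
    have hε : (0 : ℝ) < (1 / 2) ^ (m + 1) := by positivity
    have hε' : ((1 : ℝ) / 2) ^ m ≤ 1 := pow_le_one₀ (by norm_num) (by norm_num)
    obtain ⟨N, hN⟩ := eventually_atTop.1 (hS.eventually_lt_const hε)
    obtain ⟨j, hj⟩ := ((Finset.range N).eventually_all.2
      fun t _ => (hy t).eventually_lt_const hε).exists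
    refine ⟨j, fun t => ?_⟩
    have h₁ := hSB t
    have h₂ := hyB j t
    rw [pow_succ] at *
    simp only at *
    rcases lt_or_ge t N with ht | ht
    · linarith [hj t (Finset.mem_range.2 ht)]
    · linarith [hN t ht]
  choose f hf using step
  let next (q : {q : ℕ × (ℕ → ℝ) // Tendsto q.2 atTop (𝓝 0) ∧
      ∀ t, q.2 t ≤ B + 1 - (1 / 2) ^ q.1}) : {q : ℕ × (ℕ → ℝ) // Tendsto q.2 atTop (𝓝 0) ∧
      ∀ t, q.2 t ≤ B + 1 - (1 / 2) ^ q.1} :=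
    ⟨(q.1.1 + 1, fun t => q.1.2 t + y (f q) t), by simpa using q.2.1.add (hy₀ (f q)), hf q⟩
  let s (m : ℕ) := next^[m] ⟨(0, fun _ => 0), tendsto_const_nhds, fun _ => by simpa using hB⟩
  have hs (M t : ℕ) : ∑ m ∈ Finset.range M, y (f (s m)) t = (s M).1.2 t := by
    induction M with
    | zero => simp [s]
    | succ M ih =>
      have : s (M + 1) = next (s M) := Function.iterate_succ_apply' ..
      rw [Finset.sum_range_succ, ih, this]
  refine ⟨fun m => f (s m), fun M t => ?_⟩
  rw [hs]
  exact ((s M).2.2 t).trans (sub_le_self _ (by positivity))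

section CopyOfC0

variable {𝕜 F : Type*} [RCLike 𝕜] [NormedAddCommGroup F] [NormedSpace 𝕜 F]

lemma norm_apply_le_s2 (f : ZeroAtInftyContinuousMap ℕ 𝕜) (t : ℕ) : ‖f t‖ ≤ ‖f‖ := by
  rw [← ZeroAtInftyContinuousMap.norm_toBCF_eq_norm]
  exact f.toBCF.norm_coe_le_norm t

lemma norm_le_of_forall_apply_le {f : ZeroAtInftyContinuousMap ℕ 𝕜} {M : ℝ} (hM : 0 ≤ M)
    (h : ∀ t, ‖f t‖ ≤ M) : ‖f‖ ≤ M := by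
  rw [← ZeroAtInftyContinuousMap.norm_toBCF_eq_norm]
  exact (BoundedContinuousFunction.norm_le hM).2 h

lemma tendsto_apply_atTop (f : ZeroAtInftyContinuousMap ℕ 𝕜) : Tendsto f atTop (𝓝 0) := by
  have := f.zero_at_infty'
  rwa [Filter.cocompact_eq_cofinite, Nat.cofinite_eq_atTop] at this

lemma norm_sum_smul_le {y : ℕ → F} {C : ℝ}
    (hC : ∀ (A : Finset ℕ) (a : ℕ → 𝕜), (∀ i, ‖a i‖ ≤ 1) → ‖∑ i ∈ A, a i • y i‖ ≤ C)
    (A : Finset ℕ) (a : ℕ → 𝕜) {r : ℝ} (hr : 0 < r) (ha : ∀ i ∈ A, ‖a i‖ ≤ r) :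
    ‖∑ i ∈ A, a i • y i‖ ≤ C * r := by
  have h := hC A (fun i => if i ∈ A then (r : 𝕜)⁻¹ * a i else 0) fun i => by
    split_ifs with hi
    · rw [norm_mul, norm_inv, RCLike.norm_ofReal, abs_of_pos hr, inv_mul_le_one₀ hr]
      exact ha i hi
    · simp
  have heq : ∑ i ∈ A, (if i ∈ A then (r : 𝕜)⁻¹ * a i else 0) • y i
      = (r : 𝕜)⁻¹ • ∑ i ∈ A, a i • y i := by
    rw [Finset.smul_sum]
    exact Finset.sum_congr rfl fun i hi => by rw [if_pos hi, mul_smul]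
  rwa [heq, norm_smul, norm_inv, RCLike.norm_ofReal, abs_of_pos hr, inv_mul_le_iff₀ hr,
    mul_comm] at h

lemma summable_smul_of_norm_sum_le [CompleteSpace F] {y : ℕ → F} {C : ℝ}
    (hC : ∀ (A : Finset ℕ) (a : ℕ → 𝕜), (∀ i, ‖a i‖ ≤ 1) → ‖∑ i ∈ A, a i • y i‖ ≤ C)
    (f : ZeroAtInftyContinuousMap ℕ 𝕜) : Summable fun i => f i • y i := by
  rw [summable_iff_vanishing_norm]
  intro ε hε
  have hC₀ : 0 ≤ C := by simpa using hC ∅ 0 (by simp)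
  have hr : 0 < ε / (C + 1) := by positivity
  obtain ⟨N, hN⟩ := eventually_atTop.1 ((tendsto_apply_atTop f).norm.eventually_lt_const
    (by simpa using hr))
  refine ⟨Finset.range N, fun t ht => ?_⟩
  refine (norm_sum_smul_le hC t f hr fun i hi => (hN i ?_).le).trans_lt ?_
  · by_contra! h
    exact Finset.disjoint_left.1 ht hi (Finset.mem_range.2 h)
  · rw [mul_div_assoc', div_lt_iff₀ (by positivity)]
    nlinarith

/-- A weakly unconditionally Cauchy series whose terms are bounded away from zero yields a copy
of `c₀` (Bessaga–Pełczyński). -/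
lemma containsCopyOfC0_of_norm_sum_le [CompleteSpace F] {y : ℕ → F} {C δ : ℝ} (hδ : 0 < δ)
    (hC : ∀ (A : Finset ℕ) (a : ℕ → 𝕜), (∀ i, ‖a i‖ ≤ 1) → ‖∑ i ∈ A, a i • y i‖ ≤ C)
    (hy : ∀ m, δ ≤ ‖y m‖) : ContainsCopyOfC0 𝕜 F := by
  choose g hg hgy using fun m => exists_dual_vector'' 𝕜 (y m)
  have hrow (m : ℕ) (A : Finset ℕ) : ∑ i ∈ A, ‖g m (y i)‖ ≤ C := by
    have h := hC A (fun i => (‖g m (y i)‖ : 𝕜)⁻¹ * (starRingEnd 𝕜) (g m (y i))) fun i => by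
      simp only [norm_mul, norm_inv, RCLike.norm_conj, RCLike.norm_ofReal, abs_norm]
      exact inv_mul_le_one
    have heq : g m (∑ i ∈ A, ((‖g m (y i)‖ : 𝕜)⁻¹ * (starRingEnd 𝕜) (g m (y i))) • y i)
        = ((∑ i ∈ A, ‖g m (y i)‖ : ℝ) : 𝕜) := by
      rw [map_sum, RCLike.ofReal_sum]
      refine Finset.sum_congr rfl fun i _ => ?_
      rw [map_smul, smul_eq_mul, mul_assoc, RCLike.conj_mul]
      by_cases h0 : (‖g m (y i)‖ : 𝕜) = 0
      · simp [h0]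
      · field_simp
    have h' := (g m).le_of_opNorm_le (hg m)
      (∑ i ∈ A, ((‖g m (y i)‖ : 𝕜)⁻¹ * (starRingEnd 𝕜) (g m (y i))) • y i)
    rw [heq, RCLike.norm_ofReal, one_mul] at h'
    exact (le_abs_self _).trans (h'.trans h)
  obtain ⟨k, hk⟩ := exists_nat_ge (C / (δ / 2))
  obtain ⟨σ, hσ, hoff⟩ := exists_injective_offDiag_sum_le (half_pos hδ).le k
    (fun m i => ‖g m (y i)‖) (fun _ _ => norm_nonneg _)
    fun m A => (hrow m A).trans ((div_le_iff₀ (half_pos hδ)).1 hk)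
  have hCσ (A : Finset ℕ) (a : ℕ → 𝕜) (ha : ∀ i, ‖a i‖ ≤ 1) :
      ‖∑ i ∈ A, a i • y (σ i)‖ ≤ C := by
    have h := hC (A.image σ) (fun i => a (Function.invFun σ i)) fun i => ha _
    simpa only [Finset.sum_image hσ.injOn, Function.leftInverse_invFun hσ _] using h
  have hsum := summable_smul_of_norm_sum_le hCσ
  let L : ZeroAtInftyContinuousMap ℕ 𝕜 →ₗ[𝕜] F :=
    { toFun := fun f => ∑' i, f i • y (σ i)
      map_add' := fun f f' => by
        simp only [ZeroAtInftyContinuousMap.add_apply, add_smul]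
        exact (hsum f).tsum_add (hsum f')
      map_smul' := fun c f => by
        simp only [ZeroAtInftyContinuousMap.smul_apply, smul_assoc, RingHom.id_apply]
        exact (hsum f).tsum_const_smul c }
  have hupper (f : ZeroAtInftyContinuousMap ℕ 𝕜) : ‖L f‖ ≤ C * ‖f‖ := by
    rcases eq_or_ne f 0 with rfl | hf
    · simp
    · exact le_of_tendsto' (hsum f).hasSum.norm fun A =>
        norm_sum_smul_le hCσ A f (norm_pos_iff.2 hf) fun i _ => norm_apply_le_s2 f i
  have hlower (f : ZeroAtInftyContinuousMap ℕ 𝕜) (m : ℕ) :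
      ‖f m‖ * δ - ‖f‖ * (δ / 2) ≤ ‖L f‖ := by
    refine ge_of_tendsto (hsum f).hasSum.norm ((eventually_ge_atTop {m}).mono fun A hA => ?_)
    replace hA : m ∈ A := Finset.singleton_subset_iff.1 hA
    have h₁ := (g (σ m)).le_of_opNorm_le (hg (σ m)) (∑ i ∈ A, f i • y (σ i))
    rw [one_mul, map_sum, ← Finset.add_sum_erase A _ hA] at h₁
    have h₂ : ‖∑ i ∈ A.erase m, g (σ m) (f i • y (σ i))‖ ≤ ‖f‖ * (δ / 2) := by
      calc _ ≤ ∑ i ∈ A.erase m, ‖f‖ * ‖g (σ m) (y (σ i))‖ := by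
            refine norm_sum_le_of_le _ fun i _ => ?_
            rw [map_smul, norm_smul]
            gcongr
            exact norm_apply_le_s2 f i
        _ ≤ ‖f‖ * (δ / 2) := by
            rw [← Finset.mul_sum]
            gcongr
            exact hoff m _ (Finset.notMem_erase m A)
    have h₃ : ‖f m‖ * δ ≤ ‖g (σ m) (f m • y (σ m))‖ := by
      rw [map_smul, norm_smul, hgy, RCLike.norm_ofReal, abs_norm]
      gcongr
      exact hy _
    linarith [norm_sub_le_norm_add (g (σ m) (f m • y (σ m)))
      (∑ i ∈ A.erase m, g (σ m) (f i • y (σ i)))]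
  refine ⟨L.mkContinuous C hupper, δ / 2, max C (δ / 2), half_pos hδ, le_max_right _ _,
    fun f => ⟨?_, (hupper f).trans (by gcongr; exact le_max_left _ _)⟩⟩
  have h : ‖f‖ ≤ (‖L f‖ + ‖f‖ * (δ / 2)) / δ :=
    norm_le_of_forall_apply_le (by positivity) fun m => by
      rw [le_div_iff₀ hδ]
      linarith [hlower f m]
  rw [le_div_iff₀ hδ] at h
  rw [LinearMap.mkContinuous_apply]
  linarith

end CopyOfC0

section Multilinear

variable {𝕜 ι E F : Type*} [RCLike 𝕜] [Fintype ι] [Nonempty ι] [NormedAddCommGroup E]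
  [NormedSpace 𝕜 E] [NormedAddCommGroup F] [NormedSpace 𝕜 F]

/-- The coordinatewise sign changes `η` with weights `1 + ∏ η` average `T (z + η x)` to
`T z + T x`. -/
lemma norm_map_add_map_add_le (T : MultilinearMap 𝕜 (fun _ : ι => E) F) (z x : ι → E) (R : F)
    {K : ℝ} (h : ∀ η : ι → ℤˣ, ‖T (fun k => z k + ((η k : ℤ) : 𝕜) • x k) + R‖ ≤ K) :
    ‖T z + T x + R‖ ≤ K := by
  classical
  let w : (ι → ℤˣ) → ℤ := fun η => 1 + ∏ k, (η k : ℤ)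
  have huniv : (Finset.univ : Finset ℤˣ) = {1, -1} := rfl
  have hne : (1 : ℤˣ) ≠ -1 := by decide
  have hw₀ (η : ι → ℤˣ) : 0 ≤ w η := by
    have : ∏ k, (η k : ℤ) = ((∏ k, η k : ℤˣ) : ℤ) := by simp
    simp only [w, this]
    rcases Int.units_eq_one_or (∏ k, η k) with h | h <;> simp [h]
  have hprod : ∑ η : ι → ℤˣ, ∏ k, (η k : ℤ) = 0 := by
    have := Finset.prod_univ_sum (fun _ : ι => (Finset.univ : Finset ℤˣ)) (fun _ u => (u : ℤ))
    rw [Fintype.piFinset_univ] at this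
    rw [← this]
    exact Finset.prod_eq_zero (Finset.mem_univ (Classical.arbitrary ι)) (by simp [huniv, hne])
  have hw : ∑ η, w η = 2 ^ Fintype.card ι := by
    simp only [w, Finset.sum_add_distrib, hprod]
    simp [Fintype.card_units_int]
  have hz : ∑ η : ι → ℤˣ, T (fun k => z k + ((η k : ℤ) : 𝕜) • x k)
      = (2 : 𝕜) ^ Fintype.card ι • T z := by
    rw [← T.map_sum (fun k (u : ℤˣ) => z k + ((u : ℤ) : 𝕜) • x k)]
    have : (fun k => ∑ u : ℤˣ, (z k + ((u : ℤ) : 𝕜) • x k)) = fun k => (2 : 𝕜) • z k := by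
      ext k
      simp [huniv, hne, two_smul]
      abel
    rw [this, T.map_smul_univ]
    simp
  have hx : ∑ η : ι → ℤˣ, (∏ k, ((η k : ℤ) : 𝕜)) • T (fun k => z k + ((η k : ℤ) : 𝕜) • x k)
      = (2 : 𝕜) ^ Fintype.card ι • T x := by
    simp only [← T.map_smul_univ]
    rw [← T.map_sum (fun k (u : ℤˣ) => ((u : ℤ) : 𝕜) • (z k + ((u : ℤ) : 𝕜) • x k))]
    have : (fun k => ∑ u : ℤˣ, ((u : ℤ) : 𝕜) • (z k + ((u : ℤ) : 𝕜) • x k))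
        = fun k => (2 : 𝕜) • x k := by
      ext k
      simp [huniv, hne, two_smul]
      abel
    rw [this, T.map_smul_univ]
    simp
  have key : (2 : 𝕜) ^ Fintype.card ι • (T z + T x + R)
      = ∑ η, ((w η : ℤ) : 𝕜) • (T (fun k => z k + ((η k : ℤ) : 𝕜) • x k) + R) := by
    simp only [smul_add _ _ R, Finset.sum_add_distrib, ← Finset.sum_smul]
    rw [← Int.cast_sum, hw, smul_add, ← hz, ← hx]
    simp [w, add_smul, Finset.sum_add_distrib]
  have hnorm : (2 : ℝ) ^ Fintype.card ι * ‖T z + T x + R‖ ≤ 2 ^ Fintype.card ι * K := by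
    calc (2 : ℝ) ^ Fintype.card ι * ‖T z + T x + R‖
        = ‖(2 : 𝕜) ^ Fintype.card ι • (T z + T x + R)‖ := by
          rw [norm_smul, norm_pow, RCLike.norm_ofNat]
      _ ≤ ∑ η, (w η : ℝ) * K := by
          rw [key]
          refine norm_sum_le_of_le _ fun η _ => ?_
          have hwη : ‖((w η : ℤ) : 𝕜)‖ = (w η : ℝ) := by
            rw [← RCLike.ofReal_intCast, RCLike.norm_ofReal,
              abs_of_nonneg (Int.cast_nonneg (hw₀ η))]
          rw [norm_smul, hwη]
          exact mul_le_mul_of_nonneg_left (h η) (Int.cast_nonneg (hw₀ η))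
      _ = 2 ^ Fintype.card ι * K := by
          rw [← Finset.sum_mul, ← Int.cast_sum, hw]
          simp
  exact le_of_mul_le_mul_left hnorm (by positivity)

/-- The diagonal sums of a multilinear map are controlled by its bound on the combinations of the
arguments with coefficients of modulus at most one. -/
lemma norm_map_add_sum_diag_le (T : MultilinearMap 𝕜 (fun _ : ι => E) F) {M K : ℝ}
    (hT : ∀ v : ι → E, (∀ k, ‖v k‖ ≤ M) → ‖T v‖ ≤ K) (x : ℕ → ι → E) (A : Finset ℕ) (z : ι → E)
    (h : ∀ a : ℕ → 𝕜, (∀ j, ‖a j‖ ≤ 1) → ∀ k, ‖z k + ∑ j ∈ A, a j • x j k‖ ≤ M) :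
    ‖T z + ∑ j ∈ A, T (x j)‖ ≤ K := by
  induction A using Finset.induction_on generalizing z with
  | empty => simpa using hT z (by simpa using h 0 (by simp))
  | insert b A hb ih =>
    rw [Finset.sum_insert hb, ← add_assoc]
    refine norm_map_add_map_add_le T z (x b) _ fun η => ih _ fun a ha k => ?_
    have hη : ‖((η k : ℤ) : 𝕜)‖ ≤ 1 := by
      rcases Int.units_eq_one_or (η k) with h | h <;> simp [h]
    have := h (Function.update a b ((η k : ℤ) : 𝕜)) (fun j => by
      rcases eq_or_ne j b with rfl | hj
      · simpa using hη
      · simpa [hj] using ha j) k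
    rw [Finset.sum_insert hb, Function.update_self, ← add_assoc] at this
    convert this using 3
    refine Finset.sum_congr rfl fun j hj => ?_
    rw [Function.update_of_ne (ne_of_mem_of_not_mem hj hb)]

end Multilinear

section Main

variable {𝕜 F : Type*} [RCLike 𝕜] [NormedAddCommGroup F] [NormedSpace 𝕜 F]

/-- Bounded multilinear maps from powers of `c₀` into a space without copies of `c₀` send bounded
pointwise null sequences to null sequences. -/
lemma tendsto_map_zero_of_tendsto_apply_zero {ι : Type*} [Fintype ι] [Nonempty ι]
    [CompleteSpace F] (hF : ¬ ContainsCopyOfC0 𝕜 F)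
    (T : MultilinearMap 𝕜 (fun _ : ι => ZeroAtInftyContinuousMap ℕ 𝕜) F)
    (hT : ∀ M, ∃ K, ∀ v : ι → ZeroAtInftyContinuousMap ℕ 𝕜, (∀ k, ‖v k‖ ≤ M) → ‖T v‖ ≤ K)
    (x : ℕ → ι → ZeroAtInftyContinuousMap ℕ 𝕜) {B : ℝ} (hB : ∀ j k, ‖x j k‖ ≤ B)
    (hx : ∀ k t, Tendsto (fun j => x j k t) atTop (𝓝 0)) :
    Tendsto (fun j => T (x j)) atTop (𝓝 0) := by
  classical
  by_contra hcon
  rw [Metric.tendsto_nhds] at hcon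
  push Not at hcon
  obtain ⟨δ, hδ, hfreq⟩ := hcon
  obtain ⟨φ, hφ, hφδ⟩ := extraction_of_frequently_atTop hfreq
  have hB₀ : 0 ≤ B := (norm_nonneg _).trans (hB 0 (Classical.arbitrary ι))
  obtain ⟨ψ, hψ⟩ := exists_sum_le_of_tendsto_zero (B := Fintype.card ι * B) (by positivity)
    (fun j t => ∑ k, ‖x (φ j) k t‖)
    (fun j t => by
      simpa using Finset.sum_le_card_nsmul Finset.univ (fun k => ‖x (φ j) k t‖) B
        fun k _ => (norm_apply_le_s2 _ t).trans (hB _ k))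
    (fun j => by
      simpa using tendsto_finsetSum Finset.univ
        fun k _ => (tendsto_apply_atTop (x (φ j) k)).norm)
    (fun t => by
      simpa using tendsto_finsetSum Finset.univ
        fun k _ => ((hx k t).comp hφ.tendsto_atTop).norm)
  let u : ℕ → ι → ZeroAtInftyContinuousMap ℕ 𝕜 := fun m => x (φ (ψ m))
  obtain ⟨K, hK⟩ := hT (Fintype.card ι * B + 1)
  have hbound (A : Finset ℕ) (a : ℕ → 𝕜) (ha : ∀ i, ‖a i‖ ≤ 1) (k : ι) :
      ‖∑ j ∈ A, a j • u j k‖ ≤ Fintype.card ι * B + 1 := by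
    refine norm_le_of_forall_apply_le (by positivity) fun t => ?_
    have heval : (∑ j ∈ A, a j • u j k) t = ∑ j ∈ A, a j * u j k t := by
      induction A using Finset.induction_on with
      | empty => simp
      | insert b A hb ih => simp [Finset.sum_insert hb, ih]
    obtain ⟨N, hN⟩ := A.exists_nat_subset_range
    rw [heval]
    refine le_trans ?_ (hψ N t)
    calc ‖∑ j ∈ A, a j * u j k t‖ ≤ ∑ j ∈ A, ∑ k, ‖u j k t‖ := by
          refine norm_sum_le_of_le _ fun j _ => ?_
          rw [norm_mul]
          refine (mul_le_of_le_one_left (norm_nonneg _) (ha j)).trans ?_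
          exact Finset.single_le_sum (f := fun k => ‖u j k t‖) (fun _ _ => norm_nonneg _)
            (Finset.mem_univ k)
      _ ≤ ∑ j ∈ Finset.range N, ∑ k, ‖u j k t‖ :=
          Finset.sum_le_sum_of_subset_of_nonneg hN fun _ _ _ => by positivity
  refine hF (containsCopyOfC0_of_norm_sum_le (y := fun m => T (u m)) (C := K) hδ
    (fun A a ha => ?_) fun m => by simpa using hφδ (ψ m))
  let k₀ := Classical.arbitrary ι
  let v : ℕ → ι → ZeroAtInftyContinuousMap ℕ 𝕜 :=
    fun j => Function.update (u j) k₀ (a j • u j k₀)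
  have hv (j : ℕ) : T (v j) = a j • T (u j) := by
    simp only [v, T.map_update_smul, Function.update_eq_self]
  have h := norm_map_add_sum_diag_le T hK v A 0 fun c hc k => by
    rw [Pi.zero_apply, zero_add]
    rcases eq_or_ne k k₀ with rfl | hk
    · simpa [v, mul_smul] using hbound A (fun j => c j * a j) (fun j => by
        rw [norm_mul]
        exact mul_le_one₀ (hc j) (norm_nonneg _) (ha j)) k₀
    · simpa [v, hk] using hbound A c hc k
  simpa [hv, T.map_coord_zero (m := 0) k₀ rfl] using h

lemma exists_norm_le_of_weakly_tendsto {E : Type*} [NormedAddCommGroup E] [NormedSpace 𝕜 E]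
    {x : ℕ → E} {x₀ : E}
    (hx : ∀ φ : E →L[𝕜] 𝕜, Tendsto (fun j => φ (x j)) atTop (𝓝 (φ x₀))) :
    ∃ B, ∀ j, ‖x j‖ ≤ B := by
  obtain ⟨B, hB⟩ := banach_steinhaus
    (g := fun j => NormedSpace.inclusionInDoubleDualLi (E := E) 𝕜 (x j)) fun φ => by
      obtain ⟨C, hC⟩ := (hx φ).norm.bddAbove_range
      exact ⟨C, fun j => hC ⟨j, rfl⟩⟩
  exact ⟨B, fun j => by simpa only [LinearIsometry.norm_map] using hB j⟩

lemma tendsto_apply_of_weakly_tendsto {x : ℕ → ZeroAtInftyContinuousMap ℕ 𝕜}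
    {x₀ : ZeroAtInftyContinuousMap ℕ 𝕜}
    (hx : ∀ φ : ZeroAtInftyContinuousMap ℕ 𝕜 →L[𝕜] 𝕜,
      Tendsto (fun j => φ (x j)) atTop (𝓝 (φ x₀))) (t : ℕ) :
    Tendsto (fun j => x j t) atTop (𝓝 (x₀ t)) :=
  hx (LinearMap.mkContinuous
    { toFun := fun f => f t
      map_add' := fun _ _ => rfl
      map_smul' := fun _ _ => rfl } 1 fun f => by simpa using norm_apply_le_s2 f t)

end Main

theorem stmt2 (𝕜 : Type*) [RCLike 𝕜] (n : ℕ) (hn : 1 ≤ n)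
    (F : Type*) [NormedAddCommGroup F] [NormedSpace 𝕜 F] [CompleteSpace F]
    (hF : ¬ ContainsCopyOfC0 𝕜 F)
    (T : ContinuousMultilinearMap 𝕜 (fun _ : Fin n => ZeroAtInftyContinuousMap ℕ 𝕜) F) :
    WeaklySeqContinuous T := by
  classical
  intro x x₀ hx
  choose B hB using fun i => exists_norm_le_of_weakly_tendsto (hx i)
  have hbound (j : ℕ) (i : Fin n) : ‖x j i - x₀ i‖ ≤ ∑ i, (B i + ‖x₀ i‖) := by
    have hnn (i : Fin n) : 0 ≤ B i + ‖x₀ i‖ :=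
      add_nonneg ((norm_nonneg _).trans (hB i 0)) (norm_nonneg _)
    exact (norm_sub_le _ _).trans ((add_le_add_left (hB i j) _).trans
      (Finset.single_le_sum (f := fun i => B i + ‖x₀ i‖) (fun i _ => hnn i) (Finset.mem_univ i)))
  have hnull (i : Fin n) (t : ℕ) : Tendsto (fun j => (x j i - x₀ i) t) atTop (𝓝 0) := by
    simpa using (tendsto_apply_of_weakly_tendsto (hx i) t).sub_const (x₀ i t)
  have hsplit (j : ℕ) : T (x j)
      = ∑ s : Finset (Fin n), T (s.piecewise (x j - x₀) x₀) := by
    rw [← T.map_add_univ, sub_add_cancel]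
  have hterm (s : Finset (Fin n)) : Tendsto (fun j => T (s.piecewise (x j - x₀) x₀)) atTop
      (𝓝 (if s = ∅ then T x₀ else 0)) := by
    split_ifs with hs
    · subst hs
      simp
    · have : Nonempty {i // i ∈ s} := (Finset.nonempty_iff_ne_empty.2 hs).to_subtype
      refine tendsto_map_zero_of_tendsto_apply_zero hF
        (T.toMultilinearMap.domDomRestrict (· ∈ s) fun i => x₀ i) (fun M => ?_)
        (fun j i => x j i - x₀ i) (fun j i => hbound j i) fun i t => hnull i t
      refine ⟨‖T‖ * ∏ i, max M ‖x₀ i‖, fun v hv => ?_⟩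
      refine (T.le_opNorm _).trans ?_
      gcongr with i
      split_ifs with hi
      · exact (hv _).trans (le_max_left _ _)
      · exact le_max_right _ _
  simp only [hsplit _]
  simpa using tendsto_finsetSum Finset.univ fun s _ => hterm s

end GV
end
end

section
/- Let n ≥ 1 and suppose that for every 1 ≤ k ≤ n, every continuous k-linear map from c₀ × ⋯ × c₀ (k factors) to the Banach space F is weakly sequentially continuous at the origin (i.e., whenever (x_i^j)_j are weakly null sequences in c₀ for 1 ≤ i ≤ k, one has ‖S(x_1^j,…,x_k^j)‖ → 0). Then every continuous n-linear map T : c₀ × ⋯ × c₀ → F is weakly sequentially continuous. -/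
open Filter Topology

noncomputable section

namespace GV

/-- Freezing the arguments outside a finset of size `k` turns a continuous `n`-linear map into a
continuous `k`-linear map. -/
theorem exists_continuousMultilinearMap_piecewise {𝕜 E F : Type*} [RCLike 𝕜]
    [NormedAddCommGroup E] [NormedSpace 𝕜 E] [NormedAddCommGroup F] [NormedSpace 𝕜 F] {n k : ℕ}
    (T : ContinuousMultilinearMap 𝕜 (fun _ : Fin n => E) F) (z : Fin n → E)
    (s : Finset (Fin n)) (e : s ≃ Fin k) :
    ∃ S : ContinuousMultilinearMap 𝕜 (fun _ : Fin k => E) F,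
      ∀ y : Fin n → E, S (fun i => y (e.symm i)) = T (s.piecewise y z) := by
  refine ⟨⟨(T.toMultilinearMap.domDomRestrict (· ∈ s) (fun i => z i)).domDomCongr e, ?_⟩, ?_⟩
  · change Continuous fun x : Fin k → E =>
      T fun j => if hj : j ∈ s then x (e ⟨j, hj⟩) else z j
    refine T.cont.comp (continuous_pi fun j => ?_)
    by_cases hj : j ∈ s
    · simpa only [hj, dite_true] using continuous_apply (e ⟨j, hj⟩)
    · simpa only [hj, dite_false] using continuous_const
  · intro y
    change T (fun j => if hj : j ∈ s then y (e.symm (e ⟨j, hj⟩)) else z j) = _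
    congr 1
    ext1 j
    by_cases hj : j ∈ s <;> simp [hj]

theorem stmt5 (𝕜 : Type*) [RCLike 𝕜] (n : ℕ) (hn : 1 ≤ n)
    (F : Type*) [NormedAddCommGroup F] [NormedSpace 𝕜 F] [CompleteSpace F]
    (h : ∀ k : ℕ, 1 ≤ k → k ≤ n →
      ∀ S : ContinuousMultilinearMap 𝕜 (fun _ : Fin k => ZeroAtInftyContinuousMap ℕ 𝕜) F,
      ∀ x : ℕ → Fin k → ZeroAtInftyContinuousMap ℕ 𝕜,
        (∀ (i : Fin k) (φ : ZeroAtInftyContinuousMap ℕ 𝕜 →L[𝕜] 𝕜),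
          Tendsto (fun j => φ (x j i)) atTop (𝓝 0)) →
        Tendsto (fun j => ‖S (x j)‖) atTop (𝓝 0)) :
    ∀ T : ContinuousMultilinearMap 𝕜 (fun _ : Fin n => ZeroAtInftyContinuousMap ℕ 𝕜) F,
      WeaklySeqContinuous T := by
  intro T x x₀ hx
  have hsum : ∀ j, T (x j) = ∑ s : Finset (Fin n), T (s.piecewise (x j - x₀) x₀) := fun j => by
    rw [← T.map_add_univ, sub_add_cancel]
  have hlim : T x₀ = ∑ s : Finset (Fin n), if s = ∅ then T x₀ else 0 := by simp
  simp_rw [hsum]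
  rw [hlim]
  refine tendsto_finsetSum _ fun s _ => ?_
  rcases s.eq_empty_or_nonempty with rfl | hs
  · simp
  · rw [if_neg hs.ne_empty]
    obtain ⟨S, hS⟩ := exists_continuousMultilinearMap_piecewise T x₀ s s.equivFin
    simp_rw [← hS]
    refine tendsto_zero_iff_norm_tendsto_zero.2 (h s.card hs.card_pos ?_ S
      (fun j i => (x j - x₀) (s.equivFin.symm i)) fun i φ => ?_)
    · simpa using s.card_le_univ
    · simpa using (hx (s.equivFin.symm i) φ).sub_const (φ (x₀ (s.equivFin.symm i)))

end GV
end
end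

section
/- Let n ≥ 1, let J₁,…,Jₙ be arbitrary index sets, let F be a Banach space, and let T : c₀(J₁) × ⋯ × c₀(Jₙ) → F be a continuous n-linear map such that F contains no copy of c₀ or T is weakly sequentially continuous. Then there exist countable subsets L_k ⊆ J_k (1 ≤ k ≤ n) such that, denoting by ξ_k : c₀(J_k) → c₀(L_k) the restriction map (a_j)_{j∈J_k} ↦ (a_j)_{j∈L_k} and by ι_k : c₀(L_k) → c₀(J_k) the extension-by-zero map, the continuous n-linear map T̄ := T ∘ (ι₁,…,ιₙ) : c₀(L₁) × ⋯ × c₀(Lₙ) → F satisfies T = T̄ ∘ (ξ₁,…,ξₙ) and ‖T̄‖ = ‖T‖ (operator norms). -/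
open Filter Topology

noncomputable section

namespace GV

/-- The inclusion of a subset `L` of a discrete space `J` as a cocompact map. -/
def valCocompactMap {J : Type*} [TopologicalSpace J] [DiscreteTopology J] (L : Set J) :
    CocompactMap (↥L) J where
  toFun := Subtype.val
  continuous_toFun := continuous_subtype_val
  cocompact_tendsto' := by
    rw [Filter.cocompact_eq_cofinite, Filter.cocompact_eq_cofinite]
    exact Subtype.val_injective.tendsto_cofinite

/-- The restriction map `ξ : c₀(J) → c₀(L)`, `(a_j)_{j ∈ J} ↦ (a_j)_{j ∈ L}`. -/
def c0Restrict (𝕜 : Type*) [RCLike 𝕜] {J : Type*} [TopologicalSpace J] [DiscreteTopology J]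
    (L : Set J) :
    ZeroAtInftyContinuousMap J 𝕜 →L[𝕜] ZeroAtInftyContinuousMap (↥L) 𝕜 :=
  LinearMap.mkContinuous
    (ZeroAtInftyContinuousMap.compLinearMap (valCocompactMap L))
    1
    (fun x => by
      rw [one_mul, ← ZeroAtInftyContinuousMap.norm_toBCF_eq_norm,
        ← ZeroAtInftyContinuousMap.norm_toBCF_eq_norm]
      refine (BoundedContinuousFunction.norm_le (norm_nonneg _)).2 fun l => ?_
      exact x.toBCF.norm_coe_le_norm l.val)

/-- The extension-by-zero of an element of `c₀(L)` to an element of `c₀(J)`. -/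
def c0ExtendFun (𝕜 : Type*) [RCLike 𝕜] {J : Type*} [TopologicalSpace J] [DiscreteTopology J]
    (L : Set J) (x : ZeroAtInftyContinuousMap (↥L) 𝕜) : ZeroAtInftyContinuousMap J 𝕜 :=
  haveI := Classical.decPred (· ∈ L)
  { toFun := fun j => if h : j ∈ L then x ⟨j, h⟩ else 0
    continuous_toFun := continuous_of_discreteTopology
    zero_at_infty' := by
      have hx := zero_at_infty x
      rw [Filter.cocompact_eq_cofinite] at hx ⊢
      rw [Metric.tendsto_nhds] at hx ⊢
      intro ε hε
      refine Filter.eventually_cofinite.mpr ?_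
      refine (((Filter.eventually_cofinite.mp (hx ε hε)).image Subtype.val).subset ?_)
      intro j hj
      simp only [Set.mem_setOf_eq, Set.mem_image] at hj ⊢
      by_cases h : j ∈ L
      · rw [dif_pos h] at hj
        exact ⟨⟨j, h⟩, hj, rfl⟩
      · rw [dif_neg h] at hj
        exact absurd (by simpa using hε) hj }

/-- The extension-by-zero map `ι : c₀(L) → c₀(J)` as a continuous linear map. -/
def c0Extend (𝕜 : Type*) [RCLike 𝕜] {J : Type*} [TopologicalSpace J] [DiscreteTopology J]
    (L : Set J) :
    ZeroAtInftyContinuousMap (↥L) 𝕜 →L[𝕜] ZeroAtInftyContinuousMap J 𝕜 :=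
  LinearMap.mkContinuous
    { toFun := c0ExtendFun 𝕜 L
      map_add' := fun x y => by
        ext j
        by_cases h : j ∈ L <;> simp [c0ExtendFun, h]
      map_smul' := fun a x => by
        ext j
        by_cases h : j ∈ L <;> simp [c0ExtendFun, h] }
    1
    (fun x => by
      rw [one_mul, ← ZeroAtInftyContinuousMap.norm_toBCF_eq_norm,
        ← ZeroAtInftyContinuousMap.norm_toBCF_eq_norm]
      refine (BoundedContinuousFunction.norm_le (norm_nonneg _)).2 fun j => ?_
      show ‖c0ExtendFun 𝕜 L x j‖ ≤ ‖x.toBCF‖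
      by_cases h : j ∈ L
      · have : c0ExtendFun 𝕜 L x j = x ⟨j, h⟩ := dif_pos h
        rw [this]
        exact x.toBCF.norm_coe_le_norm ⟨j, h⟩
      · have : c0ExtendFun 𝕜 L x j = 0 := dif_neg h
        rw [this, norm_zero]
        exact norm_nonneg _)

open ZeroAtInftyContinuousMap

lemma norm_c0_le_iff {𝕜 J : Type*} [RCLike 𝕜] [TopologicalSpace J]
    {x : ZeroAtInftyContinuousMap J 𝕜} {C : ℝ} (hC : 0 ≤ C) : ‖x‖ ≤ C ↔ ∀ j, ‖x j‖ ≤ C := by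
  rw [← norm_toBCF_eq_norm]
  exact BoundedContinuousFunction.norm_le hC

lemma norm_apply_le_c0_norm {𝕜 J : Type*} [RCLike 𝕜] [TopologicalSpace J]
    (x : ZeroAtInftyContinuousMap J 𝕜) (j : J) : ‖x j‖ ≤ ‖x‖ :=
  (norm_c0_le_iff (norm_nonneg x)).1 le_rfl j

lemma c0_sum_apply {𝕜 J ι : Type*} [RCLike 𝕜] [TopologicalSpace J]
    (s : Finset ι) (f : ι → ZeroAtInftyContinuousMap J 𝕜) (j : J) :
    (∑ m ∈ s, f m) j = ∑ m ∈ s, f m j := by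
  classical
  induction s using Finset.induction_on with
  | empty => simp
  | insert k s hk ih => rw [Finset.sum_insert hk, Finset.sum_insert hk, ZeroAtInftyContinuousMap.add_apply, ih]

lemma finite_setOf_le_norm_c0 {𝕜 J : Type*} [RCLike 𝕜] [TopologicalSpace J] [DiscreteTopology J]
    (x : ZeroAtInftyContinuousMap J 𝕜) {ε : ℝ} (hε : 0 < ε) : {j | ε ≤ ‖x j‖}.Finite := by
  have hx := zero_at_infty x
  rw [Filter.cocompact_eq_cofinite, Metric.tendsto_nhds] at hx
  simpa using Filter.eventually_cofinite.mp (hx ε hε)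

/-- The canonical unit vector `e_j` of `c₀(J)`. -/
def c0Single (𝕜 : Type*) [RCLike 𝕜] {J : Type*} [TopologicalSpace J] [DiscreteTopology J]
    (j : J) : ZeroAtInftyContinuousMap J 𝕜 :=
  haveI := Classical.decEq J
  { toFun := Pi.single j 1
    continuous_toFun := continuous_of_discreteTopology
    zero_at_infty' := by
      rw [Filter.cocompact_eq_cofinite]
      refine tendsto_const_nhds.congr' ?_
      refine Filter.eventually_cofinite.mpr ((Set.finite_singleton j).subset ?_)
      intro i hi
      by_contra hij
      exact hi (Pi.single_eq_of_ne (M := fun _ => 𝕜) hij 1).symm }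

lemma c0Single_self {𝕜 J : Type*} [RCLike 𝕜] [TopologicalSpace J] [DiscreteTopology J] (j : J) :
    c0Single 𝕜 j j = 1 := by
  classical
  exact Pi.single_eq_same _ _

lemma c0Single_of_ne {𝕜 J : Type*} [RCLike 𝕜] [TopologicalSpace J] [DiscreteTopology J] {i j : J}
    (h : i ≠ j) : c0Single 𝕜 j i = 0 := by
  classical
  exact Pi.single_eq_of_ne h _

lemma norm_c0Single_le {𝕜 J : Type*} [RCLike 𝕜] [TopologicalSpace J] [DiscreteTopology J]
    (j : J) : ‖c0Single 𝕜 j‖ ≤ 1 := by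
  refine (norm_c0_le_iff zero_le_one).2 fun i => ?_
  by_cases h : i = j
  · subst h; simp [c0Single_self]
  · simp [c0Single_of_ne h]

lemma dense_span_c0Single (𝕜 J : Type*) [RCLike 𝕜] [TopologicalSpace J] [DiscreteTopology J] :
    Dense (Submodule.span 𝕜 (Set.range fun j : J => c0Single 𝕜 j) :
      Set (ZeroAtInftyContinuousMap J 𝕜)) := by
  intro x
  refine Metric.mem_closure_iff.2 fun ε hε => ?_
  set s := (finite_setOf_le_norm_c0 x (half_pos hε)).toFinset with hs
  refine ⟨∑ j ∈ s, x j • c0Single 𝕜 j, Submodule.sum_mem _ fun j _ =>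
    Submodule.smul_mem _ _ (Submodule.subset_span ⟨j, rfl⟩), ?_⟩
  rw [dist_eq_norm]
  refine lt_of_le_of_lt ((norm_c0_le_iff (half_pos hε).le).2 fun i => ?_) (half_lt_self hε)
  rw [ZeroAtInftyContinuousMap.sub_apply, c0_sum_apply]
  by_cases hi : i ∈ s
  · rw [Finset.sum_eq_single_of_mem i hi
      fun j _ hj => by rw [ZeroAtInftyContinuousMap.smul_apply, c0Single_of_ne hj.symm, smul_zero]]
    simp [ZeroAtInftyContinuousMap.smul_apply, c0Single_self, (half_pos hε).le]
  · rw [Finset.sum_eq_zero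
      fun j hj => by rw [ZeroAtInftyContinuousMap.smul_apply, c0Single_of_ne (ne_of_mem_of_not_mem hj hi).symm, smul_zero]]
    rw [sub_zero]
    by_contra hlt
    exact hi (by simpa [hs] using (not_le.1 hlt).le)

/-- A continuous multilinear map on `c₀` spaces which vanishes on all tuples of unit vectors is
zero. -/
lemma eq_zero_of_forall_c0Single {𝕜 ι : Type*} [RCLike 𝕜] [Finite ι] {J : ι → Type*}
    [∀ i, TopologicalSpace (J i)] [∀ i, DiscreteTopology (J i)]
    {F : Type*} [NormedAddCommGroup F] [NormedSpace 𝕜 F]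
    (S : ContinuousMultilinearMap 𝕜 (fun i => ZeroAtInftyContinuousMap (J i) 𝕜) F)
    (hS : ∀ j : ∀ i, J i, S (fun i => c0Single 𝕜 (j i)) = 0) : S = 0 := by
  classical
  have := Fintype.ofFinite ι
  have key : ∀ (K : Finset ι) (x : ∀ i, ZeroAtInftyContinuousMap (J i) 𝕜) (j : ∀ i, J i),
      (∀ i ∉ K, x i = c0Single 𝕜 (j i)) → S x = 0 := by
    intro K
    induction K using Finset.induction_on with
    | empty =>
      intro x j hx
      rw [← hS j]
      congr 1
      ext1 i
      exact hx i (Finset.notMem_empty i)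
    | insert k K hk ih =>
      intro x j hx
      have h0 : S.toContinuousLinearMap x k = 0 := by
        refine ContinuousLinearMap.ext_on (dense_span_c0Single 𝕜 (J k)) ?_
        rintro _ ⟨l, rfl⟩
        refine ih _ (Function.update j k l) fun i hi => ?_
        by_cases hik : i = k
        · subst hik; simp
        · rw [Function.update_of_ne hik, Function.update_of_ne hik]
          exact hx i (by simp [hik, hi])
      have h1 := congrArg (fun f => f (x k)) h0
      simpa [ContinuousMultilinearMap.toContinuousLinearMap] using h1
  ext x
  by_cases hJ : ∀ i, Nonempty (J i)
  · exact key Finset.univ x (fun i => (hJ i).some) (by simp)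
  · push Not at hJ
    obtain ⟨i, hi⟩ := hJ
    exact S.map_coord_zero i (ZeroAtInftyContinuousMap.eq_of_empty _ _)

/-- The finite sums `∑ a_m y_m` with `|a_m| ≤ 1` are bounded by `C`. -/
def UnconditionallyBounded (𝕜 : Type*) [RCLike 𝕜] {F : Type*} [NormedAddCommGroup F]
    [NormedSpace 𝕜 F] (y : ℕ → F) (C : ℝ) : Prop :=
  ∀ (s : Finset ℕ) (a : ℕ → 𝕜), (∀ m ∈ s, ‖a m‖ ≤ 1) → ‖∑ m ∈ s, a m • y m‖ ≤ C

namespace UnconditionallyBounded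

variable {𝕜 F : Type*} [RCLike 𝕜] [NormedAddCommGroup F] [NormedSpace 𝕜 F] {y : ℕ → F} {C : ℝ}

lemma nonneg (h : UnconditionallyBounded 𝕜 y C) : 0 ≤ C := by
  simpa using h ∅ 0 (by simp)

lemma comp_injective (h : UnconditionallyBounded 𝕜 y C) {f : ℕ → ℕ} (hf : f.Injective) :
    UnconditionallyBounded 𝕜 (y ∘ f) C := by
  intro s a ha
  have := h (s.map ⟨f, hf⟩) (a ∘ f.invFun) (by
    intro m hm
    obtain ⟨l, hl, rfl⟩ := Finset.mem_map.1 hm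
    simpa [Function.leftInverse_invFun hf l] using ha l hl)
  simpa [Function.leftInverse_invFun hf _] using this

lemma norm_sum_smul_le (h : UnconditionallyBounded 𝕜 y C) (s : Finset ℕ) (a : ℕ → 𝕜) {r : ℝ}
    (hr : 0 ≤ r) (ha : ∀ m ∈ s, ‖a m‖ ≤ r) : ‖∑ m ∈ s, a m • y m‖ ≤ C * r := by
  rcases hr.eq_or_lt with rfl | hr
  · rw [Finset.sum_eq_zero fun m hm => by rw [norm_le_zero_iff.1 (ha m hm), zero_smul]]
    simp
  · have h1 := h s (fun m => ((r⁻¹ : ℝ) : 𝕜) * a m) fun m hm => by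
      rw [norm_mul, RCLike.norm_ofReal, abs_of_pos (inv_pos.2 hr), inv_mul_le_iff₀ hr, mul_one]
      exact ha m hm
    simp_rw [mul_smul] at h1
    rwa [← Finset.smul_sum, norm_smul, RCLike.norm_ofReal, abs_of_pos (inv_pos.2 hr),
      inv_mul_le_iff₀ hr, mul_comm] at h1

lemma sum_norm_apply_le (h : UnconditionallyBounded 𝕜 y C) (φ : F →L[𝕜] 𝕜) (s : Finset ℕ) :
    ∑ m ∈ s, ‖φ (y m)‖ ≤ ‖φ‖ * C := by
  choose θ hθ hθφ using fun m => RCLike.exists_norm_eq_mul_self (φ (y m))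
  have h1 : φ (∑ m ∈ s, θ m • y m) = ((∑ m ∈ s, ‖φ (y m)‖ : ℝ) : 𝕜) := by
    simp [map_sum, hθφ]
  have h2 := (φ.le_opNorm (∑ m ∈ s, θ m • y m)).trans
    (mul_le_mul_of_nonneg_left (h s θ fun m _ => (hθ m).le) (norm_nonneg φ))
  rwa [h1, RCLike.norm_ofReal, abs_of_nonneg (Finset.sum_nonneg fun _ _ => norm_nonneg _)] at h2

lemma tendsto_apply_zero (h : UnconditionallyBounded 𝕜 y C) (φ : F →L[𝕜] 𝕜) :
    Tendsto (fun m => φ (y m)) atTop (𝓝 0) := by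
  rw [tendsto_zero_iff_norm_tendsto_zero]
  exact (summable_of_sum_le (fun _ => norm_nonneg _)
    (h.sum_norm_apply_le φ)).tendsto_atTop_zero

/-- If `x ∈ c₀`, then `∑ x_m y_m` converges. -/
lemma summable_smul [CompleteSpace F] (h : UnconditionallyBounded 𝕜 y C)
    (x : ZeroAtInftyContinuousMap ℕ 𝕜) : Summable fun m => x m • y m := by
  refine summable_iff_vanishing_norm.2 fun ε hε => ?_
  have hδ : 0 < ε / (C + 1) := div_pos hε (by linarith [h.nonneg])
  refine ⟨(finite_setOf_le_norm_c0 x hδ).toFinset, fun t ht => ?_⟩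
  refine (h.norm_sum_smul_le t x hδ.le fun m hm => ?_).trans_lt ?_
  · by_contra hlt
    exact Finset.disjoint_left.1 ht hm (by simpa using (not_le.1 hlt).le)
  · rw [mul_div_assoc', div_lt_iff₀ (by linarith [h.nonneg])]
    nlinarith

end UnconditionallyBounded

lemma unconditionallyBounded_c0Single {𝕜 J : Type*} [RCLike 𝕜] [TopologicalSpace J]
    [DiscreteTopology J] {j : ℕ → J} (hj : j.Injective) :
    UnconditionallyBounded 𝕜 (fun m => c0Single 𝕜 (j m)) 1 := by
  intro s a ha
  refine (norm_c0_le_iff zero_le_one).2 fun i => ?_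
  rw [c0_sum_apply]
  by_cases hi : ∃ m ∈ s, j m = i
  · obtain ⟨m, hm, rfl⟩ := hi
    rw [Finset.sum_eq_single_of_mem m hm
      fun l _ hl => by rw [ZeroAtInftyContinuousMap.smul_apply, c0Single_of_ne (hj.ne hl.symm), smul_zero]]
    simpa [ZeroAtInftyContinuousMap.smul_apply, c0Single_self] using ha m hm
  · push Not at hi
    rw [Finset.sum_eq_zero
      fun m hm => by rw [ZeroAtInftyContinuousMap.smul_apply, c0Single_of_ne (hi m hm).symm, smul_zero]]
    simp

/-- Averaging over signs bounds the trace of a matrix of vectors. -/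
lemma norm_sum_diag_le_of_signs {𝕜 F : Type*} [RCLike 𝕜] [NormedAddCommGroup F] [NormedSpace 𝕜 F]
    (B : ℕ → ℕ → F) (C : ℝ) (M : Finset ℕ) (R : F)
    (h : ∀ σ : ℕ → 𝕜, (∀ m, σ m = 1 ∨ σ m = -1) →
      ‖R + ∑ m ∈ M, ∑ l ∈ M, (σ m * σ l) • B m l‖ ≤ C) :
    ‖R + ∑ m ∈ M, B m m‖ ≤ C := by
  induction M using Finset.induction_on generalizing R with
  | empty => simpa using h 1 (by simp)
  | insert k M hk ih =>
    rw [Finset.sum_insert hk, ← add_assoc]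
    refine ih _ fun σ hσ => ?_
    have hu : ∀ m ∈ M, ∀ c : 𝕜, Function.update σ k c m = σ m := fun m hm c =>
      Function.update_of_ne (ne_of_mem_of_not_mem hm hk) _ _
    have expand : ∀ c : 𝕜, c * c = 1 →
        R + ∑ m ∈ insert k M, ∑ l ∈ insert k M,
          (Function.update σ k c m * Function.update σ k c l) • B m l =
        (R + B k k + ∑ m ∈ M, ∑ l ∈ M, (σ m * σ l) • B m l) +
          c • (∑ l ∈ M, σ l • B k l + ∑ m ∈ M, σ m • B m k) := by
      intro c hc
      rw [Finset.sum_insert hk, Finset.sum_insert hk, Function.update_self, hc, one_smul]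
      have e1 : ∑ l ∈ M, (c * Function.update σ k c l) • B k l = c • ∑ l ∈ M, σ l • B k l := by
        rw [Finset.smul_sum]
        exact Finset.sum_congr rfl fun l hl => by rw [hu l hl, mul_smul]
      have e2 : ∑ m ∈ M, ∑ l ∈ insert k M,
          (Function.update σ k c m * Function.update σ k c l) • B m l =
          c • ∑ m ∈ M, σ m • B m k + ∑ m ∈ M, ∑ l ∈ M, (σ m * σ l) • B m l := by
        rw [Finset.smul_sum, ← Finset.sum_add_distrib]
        refine Finset.sum_congr rfl fun m hm => ?_
        rw [Finset.sum_insert hk, Function.update_self, hu m hm, mul_comm, mul_smul]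
        congr 1
        exact Finset.sum_congr rfl fun l hl => by rw [hu l hl]
      rw [e1, e2, smul_add]
      abel
    have hsign : ∀ c : 𝕜, c = 1 ∨ c = -1 → ∀ m, Function.update σ k c m = 1 ∨
        Function.update σ k c m = -1 := by
      intro c hc m
      by_cases hm : m = k
      · subst hm; simpa using hc
      · rw [Function.update_of_ne hm]; exact hσ m
    have h1 := h (Function.update σ k 1) (hsign 1 (Or.inl rfl))
    have h2 := h (Function.update σ k (-1)) (hsign (-1) (Or.inr rfl))
    rw [expand 1 (by simp), one_smul] at h1
    rw [expand (-1) (by simp), neg_one_smul] at h2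
    set P := R + B k k + ∑ m ∈ M, ∑ l ∈ M, (σ m * σ l) • B m l
    set Q := ∑ l ∈ M, σ l • B k l + ∑ m ∈ M, σ m • B m k
    have h3 : ‖(2 : 𝕜) • P‖ ≤ C + C := by
      have : (2 : 𝕜) • P = (P + Q) + (P + -Q) := by rw [two_smul]; abel
      rw [this]
      exact (norm_add_le _ _).trans (add_le_add h1 h2)
    rw [norm_smul, RCLike.norm_ofNat] at h3
    linarith

/-- The diagonal of a continuous multilinear map along unconditionally bounded sequences is
unconditionally bounded. -/
lemma unconditionallyBounded_diag {𝕜 ι : Type*} [RCLike 𝕜] [Fintype ι] [DecidableEq ι]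
    {E : ι → Type*} [∀ i, NormedAddCommGroup (E i)] [∀ i, NormedSpace 𝕜 (E i)]
    {F : Type*} [NormedAddCommGroup F] [NormedSpace 𝕜 F] (T : ContinuousMultilinearMap 𝕜 E F)
    (v : ℕ → ∀ i, E i) {K : Finset ι} (hK : K.Nonempty)
    (hv : ∀ i ∈ K, UnconditionallyBounded 𝕜 (fun m => v m i) 1)
    (u : ∀ i, E i) (hu : ∀ i, ‖u i‖ ≤ 1) :
    UnconditionallyBounded 𝕜 (fun m => T (K.piecewise (v m) u)) ‖T‖ := by
  have hT : ∀ w : ∀ i, E i, (∀ i, ‖w i‖ ≤ 1) → ‖T w‖ ≤ ‖T‖ := fun w hw =>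
    T.unit_le_opNorm ((pi_norm_le_iff_of_nonneg zero_le_one).2 hw)
  have hupd : ∀ (u : ∀ i, E i), (∀ i, ‖u i‖ ≤ 1) → ∀ (i : ι) (w : E i), ‖w‖ ≤ 1 →
      ∀ k, ‖Function.update u i w k‖ ≤ 1 := by
    intro u hu i w hw k
    by_cases hk : k = i
    · subst hk; simpa using hw
    · rw [Function.update_of_ne hk]; exact hu k
  have hsum : ∀ (s : Finset ℕ) (a : ℕ → 𝕜) (w : ∀ i, E i) (i : ι) (z : ℕ → E i),
      ∑ m ∈ s, a m • T (Function.update w i (z m)) =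
        T (Function.update w i (∑ m ∈ s, a m • z m)) := by
    intro s a w i z
    have := map_sum (T.toContinuousLinearMap w i) (fun m => a m • z m) s
    simp only [map_smul] at this
    exact this.symm
  induction hK using Finset.Nonempty.cons_induction generalizing u with
  | singleton i =>
    intro s a ha
    simp only [Finset.piecewise_singleton]
    rw [hsum]
    exact hT _ (hupd u hu i _ (hv i (by simp) s a ha))
  | cons i K hi hK ih =>
    intro s a ha
    have h0 := norm_sum_diag_le_of_signs (𝕜 := 𝕜)
      (fun m l => a m • T (Function.update (K.piecewise (v m) u) i (v l i))) ‖T‖ s 0 ?_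
    · rw [zero_add] at h0
      have e : ∀ m, (Finset.cons i K hi).piecewise (v m) u =
          Function.update (K.piecewise (v m) u) i (v m i) := fun m => by
        rw [← Finset.piecewise_insert]
        congr! 1
        exact Finset.cons_eq_insert i K hi
      simpa only [e] using h0
    · intro σ hσ
      have hσ1 : ∀ m, ‖σ m‖ = 1 := fun m => by rcases hσ m with h | h <;> simp [h]
      have h1 := ih (fun k hk => hv k (by simp [hk]))
        (Function.update u i (∑ l ∈ s, σ l • v l i))
        (hupd u hu i _ (hv i (by simp) s σ fun m _ => (hσ1 m).le)) s (fun m => σ m * a m)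
        (fun m hm => by rw [norm_mul, hσ1, one_mul]; exact ha m hm)
      rw [zero_add]
      convert h1 using 3 with m hm
      beta_reduce
      rw [← Finset.update_piecewise_of_notMem K _ _ hi, ← hsum, Finset.smul_sum]
      refine Finset.sum_congr rfl fun l _ => ?_
      simp only [smul_smul]
      congr 1
      ring

/-- Rosenthal's lemma for matrices with uniformly bounded row sums. -/
lemma exists_injective_offDiag_sum_le_s8 (k : ℕ) {δ : ℝ} (a : ℕ → ℕ → ℝ)
    (ha : ∀ m (s : Finset ℕ), ∑ l ∈ s, a m l ≤ k * δ) (hδ : 0 ≤ δ) :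
    ∃ f : ℕ → ℕ, f.Injective ∧ ∀ m (s : Finset ℕ), m ∉ s → ∑ l ∈ s, a (f m) (f l) ≤ δ := by
  induction k generalizing a with
  | zero => exact ⟨id, Function.injective_id, fun m s _ => (ha m s).trans (by simpa using hδ)⟩
  | succ k ih =>
    have hinj : ∀ p, (fun q => Nat.pair p q).Injective := fun p q q' h => (Nat.pair_eq_pair.1 h).2
    by_cases hp : ∃ p, ∀ m (s : Finset ℕ), m ∉ s →
        ∑ l ∈ s, a (Nat.pair p m) (Nat.pair p l) ≤ δ
    · obtain ⟨p, hp⟩ := hp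
      exact ⟨fun q => Nat.pair p q, hinj p, hp⟩
    push Not at hp
    choose μ t hμ ht using hp
    have hg : (fun p => Nat.pair p (μ p)).Injective := fun p q h => (Nat.pair_eq_pair.1 h).1
    obtain ⟨f, hf, hfa⟩ := ih (fun p q => a (Nat.pair p (μ p)) (Nat.pair q (μ q))) (by
      intro p s
      have h1 := ha (Nat.pair p (μ p)) (s.map ⟨_, hg⟩ ∪ (t p).map ⟨_, hinj p⟩)
      rw [Finset.sum_union, Finset.sum_map, Finset.sum_map] at h1
      · have h2 := ht p
        simp only [Function.Embedding.coeFn_mk] at h1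
        push_cast at h1
        linarith
      · rw [Finset.disjoint_left]
        intro x hx hx'
        obtain ⟨q, -, rfl⟩ := Finset.mem_map.1 hx
        obtain ⟨l, hl, hlq⟩ := Finset.mem_map.1 hx'
        obtain ⟨rfl, rfl⟩ := Nat.pair_eq_pair.1 hlq
        exact hμ _ hl)
    exact ⟨fun m => Nat.pair (f m) (μ (f m)), hg.comp hf, hfa⟩

/-- Bessaga–Pełczyński: an unconditionally bounded sequence that is bounded away from zero yields
a copy of `c₀`. -/
theorem UnconditionallyBounded.containsCopyOfC0 {𝕜 F : Type*} [RCLike 𝕜] [NormedAddCommGroup F]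
    [NormedSpace 𝕜 F] [CompleteSpace F] {y : ℕ → F} {C ε : ℝ}
    (h : UnconditionallyBounded 𝕜 y C) (hε : 0 < ε) (hy : ∀ m, ε ≤ ‖y m‖) :
    ContainsCopyOfC0 𝕜 F := by
  choose φ hφ hφy using fun m => exists_dual_vector'' 𝕜 (y m)
  obtain ⟨k, hk⟩ := Archimedean.arch C (half_pos hε)
  obtain ⟨f, hf, hfa⟩ := exists_injective_offDiag_sum_le_s8 k (δ := ε / 2)
    (fun m l => ‖φ m (y l)‖) (fun m s => by
      refine (h.sum_norm_apply_le (φ m) s).trans (le_trans ?_ (hk.trans_eq (nsmul_eq_mul _ _)))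
      exact mul_le_of_le_one_left h.nonneg (hφ m)) (half_pos hε).le
  have hz := h.comp_injective hf
  set z := y ∘ f with hzdef
  have upper : ∀ x : ZeroAtInftyContinuousMap ℕ 𝕜, ‖∑' m, x m • z m‖ ≤ C * ‖x‖ := fun x =>
    le_of_tendsto (hz.summable_smul x).hasSum.norm (Eventually.of_forall fun s =>
      hz.norm_sum_smul_le s x (norm_nonneg x) fun m _ => norm_apply_le_c0_norm x m)
  have lower : ∀ x : ZeroAtInftyContinuousMap ℕ 𝕜, ε / 2 * ‖x‖ ≤ ‖∑' m, x m • z m‖ := by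
    intro x
    have hm : ∀ m, ε * ‖x m‖ ≤ ‖∑' m, x m • z m‖ + ε / 2 * ‖x‖ := by
      intro m
      refine ge_of_tendsto ((hz.summable_smul x).hasSum.norm.add_const _)
        ((eventually_ge_atTop {m}).mono fun s hs => ?_)
      have hms : m ∈ s := hs (Finset.mem_singleton_self m)
      have e1 : φ (f m) (∑ l ∈ s, x l • z l) =
          x m * (‖z m‖ : 𝕜) + ∑ l ∈ s.erase m, x l * φ (f m) (z l) := by
        rw [map_sum, ← Finset.add_sum_erase s _ hms]
        simp [hzdef, hφy]
      have e2 : ‖∑ l ∈ s.erase m, x l * φ (f m) (z l)‖ ≤ ε / 2 * ‖x‖ := by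
        refine (norm_sum_le _ _).trans ?_
        calc ∑ l ∈ s.erase m, ‖x l * φ (f m) (z l)‖
            ≤ ∑ l ∈ s.erase m, ‖x‖ * ‖φ (f m) (y (f l))‖ :=
              Finset.sum_le_sum fun l _ => by
                rw [norm_mul]
                exact mul_le_mul_of_nonneg_right (norm_apply_le_c0_norm x l) (norm_nonneg _)
          _ ≤ ε / 2 * ‖x‖ := by
              rw [← Finset.mul_sum, mul_comm]
              exact mul_le_mul_of_nonneg_right (hfa m _ (Finset.notMem_erase m s)) (norm_nonneg x)
      have e3 : ‖φ (f m) (∑ l ∈ s, x l • z l)‖ ≤ ‖∑ l ∈ s, x l • z l‖ :=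
        ((φ (f m)).le_opNorm _).trans (mul_le_of_le_one_left (norm_nonneg _) (hφ _))
      have e4 : ‖x m * (‖z m‖ : 𝕜)‖ = ‖z m‖ * ‖x m‖ := by
        rw [norm_mul, RCLike.norm_ofReal, abs_norm, mul_comm]
      have e5 : ε * ‖x m‖ ≤ ‖z m‖ * ‖x m‖ :=
        mul_le_mul_of_nonneg_right (hy (f m)) (norm_nonneg _)
      have e6 := norm_le_add_norm_add (x m * (‖z m‖ : 𝕜))
        (∑ l ∈ s.erase m, x l * φ (f m) (z l))
      rw [← e1] at e6
      linarith
    have hx : ‖x‖ ≤ (‖∑' m, x m • z m‖ + ε / 2 * ‖x‖) / ε :=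
      (norm_c0_le_iff (by positivity)).2 fun m => by
        rw [le_div_iff₀ hε, mul_comm]; exact hm m
    rw [le_div_iff₀ hε] at hx
    linarith
  refine ⟨LinearMap.mkContinuous
    { toFun := fun x => ∑' m, x m • z m
      map_add' := fun x w => by
        simp only [ZeroAtInftyContinuousMap.add_apply, add_smul]
        exact (hz.summable_smul x).tsum_add (hz.summable_smul w)
      map_smul' := fun c x => by
        simp only [ZeroAtInftyContinuousMap.smul_apply, smul_assoc, RingHom.id_apply]
        exact (hz.summable_smul x).tsum_const_smul c } C upper,
    ε / 2, max C (ε / 2), half_pos hε, le_max_right _ _, fun x => ⟨lower x, ?_⟩⟩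
  exact (upper x).trans (mul_le_mul_of_nonneg_right (le_max_left _ _) (norm_nonneg x))

lemma exists_injective_comp_const_or_injective {α : Type*} (g : ℕ → α) :
    ∃ σ : ℕ → ℕ, σ.Injective ∧ ((∃ c, ∀ m, g (σ m) = c) ∨ (g ∘ σ).Injective) := by
  by_cases h : ∃ c, (g ⁻¹' {c}).Infinite
  · obtain ⟨c, hc⟩ := h
    exact ⟨fun m => hc.natEmbedding _ m,
      Subtype.val_injective.comp (hc.natEmbedding _).injective,
      Or.inl ⟨c, fun m => (hc.natEmbedding _ m).2⟩⟩
  · have hr : (Set.range g).Infinite := by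
      intro hfin
      push Not at h
      refine Set.infinite_univ (α := ℕ) ((hfin.biUnion fun c _ => h c).subset fun m _ => ?_)
      exact Set.mem_biUnion (Set.mem_range_self m) rfl
    choose σ hσ using fun m => (hr.natEmbedding _ m).2
    have hinj : (g ∘ σ).Injective := by
      have : g ∘ σ = fun m => (hr.natEmbedding _ m : α) := funext hσ
      rw [this]
      exact Subtype.val_injective.comp (hr.natEmbedding _).injective
    exact ⟨σ, hinj.of_comp, Or.inr hinj⟩

/-- A sequence of tuples has a subsequence each of whose coordinates is constant or injective. -/
lemma exists_injective_forall_const_or_injective {ι : Type*} (K : Finset ι) {J : ι → Type*}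
    (g : ℕ → ∀ i, J i) :
    ∃ σ : ℕ → ℕ, σ.Injective ∧
      ∀ i ∈ K, (∃ c, ∀ m, g (σ m) i = c) ∨ (fun m => g (σ m) i).Injective := by
  classical
  induction K using Finset.induction_on with
  | empty => exact ⟨id, Function.injective_id, by simp⟩
  | insert k K hk ih =>
    obtain ⟨σ, hσ, hK⟩ := ih
    obtain ⟨τ, hτ, hk'⟩ := exists_injective_comp_const_or_injective fun m => g (σ m) k
    refine ⟨σ ∘ τ, hσ.comp hτ, fun i hi => ?_⟩
    rcases Finset.mem_insert.1 hi with rfl | hi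
    · exact hk'
    · rcases hK i hi with ⟨c, hc⟩ | hinj
      · exact Or.inl ⟨c, fun m => hc (τ m)⟩
      · exact Or.inr (hinj.comp hτ)

lemma finite_setOf_le_norm_apply_c0Single {𝕜 : Type*} [RCLike 𝕜] {n : ℕ}
    {J : Fin n → Type*} [∀ i, TopologicalSpace (J i)] [∀ i, DiscreteTopology (J i)]
    {F : Type*} [NormedAddCommGroup F] [NormedSpace 𝕜 F] [CompleteSpace F]
    (T : ContinuousMultilinearMap 𝕜 (fun i => ZeroAtInftyContinuousMap (J i) 𝕜) F)
    (h : ¬ ContainsCopyOfC0 𝕜 F ∨ WeaklySeqContinuous T) {ε : ℝ} (hε : 0 < ε) :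
    {j : ∀ i, J i | ε ≤ ‖T fun i => c0Single 𝕜 (j i)‖}.Finite := by
  classical
  by_contra hinf
  obtain ⟨σ, hσ, hJ⟩ := exists_injective_forall_const_or_injective Finset.univ
    (fun m => (Set.Infinite.natEmbedding _ hinf m : ∀ i, J i))
  set g : ℕ → ∀ i, J i := fun m => Set.Infinite.natEmbedding _ hinf (σ m)
  have hg : g.Injective :=
    Subtype.val_injective.comp ((Set.Infinite.natEmbedding _ hinf).injective.comp hσ)
  have hgε : ∀ m, ε ≤ ‖T fun i => c0Single 𝕜 (g m i)‖ := fun m =>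
    (Set.Infinite.natEmbedding _ hinf (σ m)).2
  set K : Finset (Fin n) := Finset.univ.filter fun i => (fun m => g m i).Injective
  have hconst : ∀ i ∉ K, ∀ m, g m i = g 0 i := by
    intro i hi m
    rcases hJ i (Finset.mem_univ i) with ⟨c, hc⟩ | hinj
    · exact (hc m).trans (hc 0).symm
    · exact absurd (Finset.mem_filter.2 ⟨Finset.mem_univ i, hinj⟩) hi
  have hK : K.Nonempty := by
    by_contra hK
    rw [Finset.not_nonempty_iff_eq_empty] at hK
    exact one_ne_zero (hg (funext fun i => hconst i (by simp [hK]) 1))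
  have hv : ∀ i ∈ K, UnconditionallyBounded 𝕜 (fun m => c0Single 𝕜 (g m i)) 1 := fun i hi =>
    unconditionallyBounded_c0Single (Finset.mem_filter.1 hi).2
  rcases h with h | h
  · have hb := unconditionallyBounded_diag T (fun m i => c0Single 𝕜 (g m i)) hK hv
      (fun i => c0Single 𝕜 (g 0 i)) (fun i => norm_c0Single_le _)
    have e : ∀ m, K.piecewise (fun i => c0Single 𝕜 (g m i)) (fun i => c0Single 𝕜 (g 0 i)) =
        fun i => c0Single 𝕜 (g m i) := by
      intro m
      ext1 i
      by_cases hi : i ∈ K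
      · simp [hi]
      · simp [hi, hconst i hi m]
    simp only [e] at hb
    exact h (hb.containsCopyOfC0 hε hgε)
  · have hlim := h (fun m i => c0Single 𝕜 (g m i))
      (K.piecewise (fun _ => 0) fun i => c0Single 𝕜 (g 0 i)) (by
        intro i φ
        by_cases hi : i ∈ K
        · simpa [hi] using (hv i hi).tendsto_apply_zero φ
        · simp [hi, hconst i hi])
    obtain ⟨i, hi⟩ := hK
    rw [T.map_coord_zero i (by simp [hi])] at hlim
    exact absurd (ge_of_tendsto hlim.norm (Eventually.of_forall hgε)) (by simpa using hε)

lemma c0Extend_c0Restrict_apply {𝕜 J : Type*} [RCLike 𝕜] [TopologicalSpace J] [DiscreteTopology J]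
    (L : Set J) (x : ZeroAtInftyContinuousMap J 𝕜) (j : J) [Decidable (j ∈ L)] :
    c0Extend 𝕜 L (c0Restrict 𝕜 L x) j = if j ∈ L then x j else 0 := by
  split_ifs with hj
  · exact dif_pos hj
  · exact dif_neg hj

lemma c0Extend_c0Restrict_single_of_mem {𝕜 J : Type*} [RCLike 𝕜] [TopologicalSpace J]
    [DiscreteTopology J] {L : Set J} {j : J} (hj : j ∈ L) :
    c0Extend 𝕜 L (c0Restrict 𝕜 L (c0Single 𝕜 j)) = c0Single 𝕜 j := by
  classical
  ext i
  rw [c0Extend_c0Restrict_apply]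
  split_ifs with hi
  · rfl
  · exact (c0Single_of_ne (ne_of_mem_of_not_mem hj hi).symm).symm

lemma c0Extend_c0Restrict_single_of_notMem {𝕜 J : Type*} [RCLike 𝕜] [TopologicalSpace J]
    [DiscreteTopology J] {L : Set J} {j : J} (hj : j ∉ L) :
    c0Extend 𝕜 L (c0Restrict 𝕜 L (c0Single 𝕜 j)) = 0 := by
  classical
  ext i
  rw [c0Extend_c0Restrict_apply]
  split_ifs with hi
  · exact c0Single_of_ne (ne_of_mem_of_not_mem hi hj)
  · rfl

lemma norm_compContinuousLinearMap_le_of_norm_le_one {𝕜 ι : Type*} [RCLike 𝕜] [Fintype ι]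
    {E E' : ι → Type*} [∀ i, NormedAddCommGroup (E i)] [∀ i, NormedSpace 𝕜 (E i)]
    [∀ i, NormedAddCommGroup (E' i)] [∀ i, NormedSpace 𝕜 (E' i)]
    {F : Type*} [NormedAddCommGroup F] [NormedSpace 𝕜 F]
    (T : ContinuousMultilinearMap 𝕜 E' F) (f : ∀ i, E i →L[𝕜] E' i) (hf : ∀ i, ‖f i‖ ≤ 1) :
    ‖T.compContinuousLinearMap f‖ ≤ ‖T‖ :=
  (T.norm_compContinuousLinearMap_le f).trans (mul_le_of_le_one_right (norm_nonneg T)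
    (Finset.prod_le_one (fun _ _ => norm_nonneg _) fun i _ => hf i))

theorem stmt8 (𝕜 : Type*) [RCLike 𝕜] (n : ℕ) (hn : 1 ≤ n)
    (J : Fin n → Type*) [∀ i, TopologicalSpace (J i)] [∀ i, DiscreteTopology (J i)]
    (F : Type*) [NormedAddCommGroup F] [NormedSpace 𝕜 F] [CompleteSpace F]
    (T : ContinuousMultilinearMap 𝕜 (fun i => ZeroAtInftyContinuousMap (J i) 𝕜) F)
    (h : ¬ ContainsCopyOfC0 𝕜 F ∨ WeaklySeqContinuous T) :
    ∃ L : ∀ i, Set (J i), (∀ i, (L i).Countable) ∧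
      T = (T.compContinuousLinearMap fun i => c0Extend 𝕜 (L i)).compContinuousLinearMap
            (fun i => c0Restrict 𝕜 (L i)) ∧
      ‖T.compContinuousLinearMap fun i => c0Extend 𝕜 (L i)‖ = ‖T‖ := by
  set A : Set (∀ i, J i) := {j | T (fun i => c0Single 𝕜 (j i)) ≠ 0}
  have hA : A.Countable := by
    refine (Set.countable_iUnion fun m : ℕ => (finite_setOf_le_norm_apply_c0Single T h
      (Nat.one_div_pos_of_nat (α := ℝ) (n := m))).countable).mono fun j hj => ?_
    obtain ⟨m, hm⟩ := exists_nat_one_div_lt (norm_pos_iff.2 hj)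
    exact Set.mem_iUnion.2 ⟨m, hm.le⟩
  have hT : T = (T.compContinuousLinearMap fun i =>
      c0Extend 𝕜 ((fun j : ∀ i, J i => j i) '' A)).compContinuousLinearMap
        fun i => c0Restrict 𝕜 ((fun j : ∀ i, J i => j i) '' A) := by
    refine sub_eq_zero.1 (eq_zero_of_forall_c0Single _ fun j => ?_)
    rw [_root_.sub_apply, sub_eq_zero]
    simp only [ContinuousMultilinearMap.compContinuousLinearMap_apply]
    by_cases hj : ∀ i, j i ∈ (fun j : ∀ i, J i => j i) '' A
    · congr 1
      ext1 i
      exact (c0Extend_c0Restrict_single_of_mem (hj i)).symm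
    · have hjA : T (fun i => c0Single 𝕜 (j i)) = 0 :=
        not_not.1 fun hjA => hj fun i => ⟨j, hjA, rfl⟩
      push Not at hj
      obtain ⟨i, hi⟩ := hj
      rw [hjA, T.map_coord_zero i (c0Extend_c0Restrict_single_of_notMem hi)]
  refine ⟨fun i => (fun j : ∀ i, J i => j i) '' A, fun i => hA.image _, hT, le_antisymm ?_ ?_⟩
  · exact norm_compContinuousLinearMap_le_of_norm_le_one _ _ fun i =>
      LinearMap.mkContinuous_norm_le _ zero_le_one _
  · conv_lhs => rw [hT]
    exact norm_compContinuousLinearMap_le_of_norm_le_one _ _ fun i =>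
      LinearMap.mkContinuous_norm_le _ zero_le_one _

end GV
end
end
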